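/- arXiv:1908.08384 — 4 statements merged into one kernel-verified Lean document; each statement's English description precedes it below -/
import Mathlib

section
/- Let K ⊆ ℝⁿ be a convex body whose centroid is the origin, i.e. ∫_K x dx = 0 with respect to Lebesgue measure, and let ε ∈ (0,1). Then there exist N ≤ (10/ε)^n points p_1,…,p_N ∈ K such that K ⊆ ⋃_{i=1}^N (p_i + (ε/2)(K ∩ −K)), and moreover p_i + ε(K ∩ −K) ⊆ (1+ε)K for every i; in other words, the translates p_i + (ε/2)(K ∩ −K) form a symmetric (2,ε)-covering of K. -/
open Pointwise MeasureTheory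

/-- Brunn–Minkowski inequality on the line. -/
theorem Real.volume_add_le_volume_of_add_subset {A B C : Set ℝ}
    (hA : MeasurableSet A) (hB : MeasurableSet B) (hA' : A.Nonempty) (hB' : B.Nonempty)
    (hC : A + B ⊆ C) : volume A + volume B ≤ volume C := by
  have key : ∀ K ⊆ A, IsCompact K → ∀ L ⊆ B, IsCompact L →
      volume K + volume L ≤ volume C := by
    have aux : ∀ K ⊆ A, IsCompact K → K.Nonempty → ∀ L ⊆ B, IsCompact L → L.Nonempty →
        volume K + volume L ≤ volume C := by
      intro K hKA hK hK0 L hLB hL hL0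
      obtain ⟨a, haK, ha⟩ := hK.exists_isGreatest hK0
      obtain ⟨b, hbL, hb⟩ := hL.exists_isLeast hL0
      have hinter : (b +ᵥ K) ∩ (a +ᵥ L) ⊆ {a + b} := by
        rintro _ ⟨⟨x, hx, rfl⟩, ⟨y, hy, hxy⟩⟩
        have h1 := ha hx
        have h2 := hb hy
        simp only [vadd_eq_add, Set.mem_singleton_iff] at hxy ⊢
        linarith
      have hdisj : AEDisjoint volume (b +ᵥ K) (a +ᵥ L) :=
        measure_mono_null hinter (by simp)
      rw [← measure_vadd volume b K, ← measure_vadd volume a L,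
        ← measure_union₀ (hL.vadd a).measurableSet.nullMeasurableSet hdisj]
      refine measure_mono (Set.union_subset ?_ ?_)
      · rintro _ ⟨x, hx, rfl⟩
        exact hC ⟨x, hKA hx, b, hLB hbL, by simp [add_comm]⟩
      · rintro _ ⟨x, hx, rfl⟩
        exact hC ⟨a, hKA haK, x, hLB hx, by simp⟩
    intro K hKA hK L hLB hL
    obtain ⟨a, ha⟩ := hA'
    obtain ⟨b, hb⟩ := hB'
    refine le_trans ?_ (aux (insert a K) (Set.insert_subset ha hKA) (hK.insert a)
      (Set.insert_nonempty _ _) (insert b L) (Set.insert_subset hb hLB) (hL.insert b)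
      (Set.insert_nonempty _ _))
    gcongr <;> exact Set.subset_insert _ _
  rw [hA.measure_eq_iSup_isCompact, hB.measure_eq_iSup_isCompact]
  simp_rw [iSup_and']
  exact ENNReal.biSup_add_biSup_le' ⟨∅, by simp⟩ ⟨∅, by simp⟩
    fun K hK L hL => key K hK.1 hK.2 L hL.1 hL.2

/-- Layer-cake formula for the truncation of a function at `1`. -/
theorem lintegral_min_one_eq_lintegral_meas_lt {α : Type*} [MeasurableSpace α]
    (μ : Measure α) [SFinite μ] {f : α → ENNReal} (hf : Measurable f) :
    ∫⁻ x, min (f x) 1 ∂μ = ∫⁻ s in Set.Ioo (0 : ℝ) 1, μ {x | ENNReal.ofReal s < f x} := by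
  have hS : MeasurableSet {p : α × ℝ | ENNReal.ofReal p.2 < f p.1} :=
    measurableSet_lt (ENNReal.measurable_ofReal.comp measurable_snd) (hf.comp measurable_fst)
  have h1 := Measure.prod_apply (μ := μ) (ν := volume.restrict (Set.Ioo (0 : ℝ) 1)) hS
  rw [Measure.prod_apply_symm hS] at h1
  refine Eq.trans ?_ h1.symm
  refine lintegral_congr fun x => ?_
  rw [Measure.restrict_apply' measurableSet_Ioo]
  rcases eq_or_ne (f x) ⊤ with h | h
  · have : (Prod.mk x ⁻¹' {p : α × ℝ | ENNReal.ofReal p.2 < f p.1}) ∩ Set.Ioo 0 1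
        = Set.Ioo 0 1 := by
      ext s; simp [h]
    rw [this, h]; simp
  · have : (Prod.mk x ⁻¹' {p : α × ℝ | ENNReal.ofReal p.2 < f p.1}) ∩ Set.Ioo 0 1
        = Set.Ioo 0 (min (f x).toReal 1) := by
      ext s
      simp only [Set.mem_inter_iff, Set.mem_preimage, Set.mem_ofPred_eq, Set.mem_Ioo, lt_min_iff]
      constructor
      · rintro ⟨h1, h2, h3⟩
        exact ⟨h2, (ENNReal.ofReal_lt_iff_lt_toReal h2.le h).1 h1, h3⟩
      · rintro ⟨h2, h1, h3⟩
        exact ⟨(ENNReal.ofReal_lt_iff_lt_toReal h2.le h).2 h1, h2, h3⟩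
    rw [this, Real.volume_Ioo, sub_zero, ENNReal.ofReal_min, ENNReal.ofReal_toReal h,
      ENNReal.ofReal_one]

/-- The additive form of the Prékopa–Leindler inequality for functions with supremum `1`. -/
theorem lintegral_le_of_min_le {f g h : ℝ → ENNReal} (hf : Measurable f)
    (hg : Measurable g) (hh : Measurable h) (hf1 : ⨆ x, f x = 1) (hg1 : ⨆ x, g x = 1)
    {a b : ℝ} (ha : 0 < a) (hb : 0 < b)
    (H : ∀ x y, min (f x) (g y) ≤ h (a * x + b * y)) :
    ENNReal.ofReal a * (∫⁻ x, f x) + ENNReal.ofReal b * ∫⁻ x, g x ≤ ∫⁻ x, h x := by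
  have ef : ∫⁻ x, f x = ∫⁻ x, min (f x) 1 :=
    lintegral_congr fun x => (min_eq_left (hf1 ▸ le_iSup f x)).symm
  have eg : ∫⁻ x, g x = ∫⁻ x, min (g x) 1 :=
    lintegral_congr fun x => (min_eq_left (hg1 ▸ le_iSup g x)).symm
  have mono : ∀ {u : ℝ → ENNReal}, Measurable fun s : ℝ => volume {x | ENNReal.ofReal s < u x} :=
    fun {u} => (Antitone.measurable fun s t hst =>
      measure_mono fun x hx => lt_of_le_of_lt (ENNReal.ofReal_le_ofReal hst) hx)
  calc _ = ∫⁻ s in Set.Ioo (0 : ℝ) 1, (ENNReal.ofReal a * volume {x | ENNReal.ofReal s < f x}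
        + ENNReal.ofReal b * volume {x | ENNReal.ofReal s < g x}) := by
        rw [ef, eg, lintegral_min_one_eq_lintegral_meas_lt _ hf,
          lintegral_min_one_eq_lintegral_meas_lt _ hg, lintegral_add_left (mono.const_mul _),
          lintegral_const_mul _ mono, lintegral_const_mul _ mono]
    _ ≤ ∫⁻ s in Set.Ioo (0 : ℝ) 1, volume {x | ENNReal.ofReal s < h x} := by
        refine setLIntegral_mono mono fun s hs => ?_
        have e : ∀ {c : ℝ}, 0 < c → ∀ S : Set ℝ,
            ENNReal.ofReal c * volume S = volume (c • S) := fun {c} hc S => by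
          rw [Measure.addHaar_smul_of_nonneg _ hc.le]; simp
        have hs1 : ENNReal.ofReal s < 1 := by
          rw [← ENNReal.ofReal_one]; exact (ENNReal.ofReal_lt_ofReal_iff one_pos).2 hs.2
        rw [e ha, e hb]
        refine Real.volume_add_le_volume_of_add_subset
          ((measurableSet_lt measurable_const hf).const_smul_of_ne_zero ha.ne')
          ((measurableSet_lt measurable_const hg).const_smul_of_ne_zero hb.ne') ?_ ?_ ?_
        · exact Set.Nonempty.smul_set (lt_iSup_iff.1 (hs1.trans_eq hf1.symm))
        · exact Set.Nonempty.smul_set (lt_iSup_iff.1 (hs1.trans_eq hg1.symm))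
        · rintro _ ⟨_, ⟨x, hx, rfl⟩, _, ⟨y, hy, rfl⟩, rfl⟩
          exact lt_of_lt_of_le (lt_min hx hy) (H x y)
    _ = ∫⁻ x, min (h x) 1 := (lintegral_min_one_eq_lintegral_meas_lt _ hh).symm
    _ ≤ ∫⁻ x, h x := lintegral_mono fun x => min_le_left _ _

theorem ENNReal.geom_mean_le_arith_mean2_weighted {a b : ℝ} (ha : 0 < a) (hb : 0 < b)
    (hab : a + b = 1) (x y : ENNReal) :
    x ^ a * y ^ b ≤ ENNReal.ofReal a * x + ENNReal.ofReal b * y := by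
  have h := ENNReal.young_inequality (x ^ a) (y ^ b) (Real.HolderConjugate.inv_inv ha hb hab)
  rw [ENNReal.rpow_rpow_inv ha.ne', ENNReal.rpow_rpow_inv hb.ne', ENNReal.ofReal_inv_of_pos ha,
    ENNReal.ofReal_inv_of_pos hb, div_eq_mul_inv, div_eq_mul_inv, inv_inv, inv_inv] at h
  rwa [mul_comm x, mul_comm y] at h

/-- Prékopa–Leindler inequality on the line, for bounded functions. -/
theorem prekopa_leindler_real_of_bounded {f g h : ℝ → ENNReal} (hf : Measurable f)
    (hg : Measurable g) (hh : Measurable h) (hf1 : ⨆ x, f x ≠ ⊤) (hg1 : ⨆ x, g x ≠ ⊤)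
    {a b : ℝ} (ha : 0 < a) (hb : 0 < b) (hab : a + b = 1)
    (H : ∀ x y, f x ^ a * g y ^ b ≤ h (a * x + b * y)) :
    (∫⁻ x, f x) ^ a * (∫⁻ x, g x) ^ b ≤ ∫⁻ x, h x := by
  set M := ⨆ x, f x with hM
  set N := ⨆ x, g x with hN
  rcases eq_or_ne M 0 with h0 | hM0
  · have : ∀ x, f x = 0 := by simpa [M] using h0
    simp [this, ENNReal.zero_rpow_of_pos ha]
  rcases eq_or_ne N 0 with h0 | hN0
  · have : ∀ x, g x = 0 := by simpa [N] using h0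
    simp [this, ENNReal.zero_rpow_of_pos hb]
  have hMa : M ^ a ≠ 0 := by simp [ENNReal.rpow_eq_zero_iff, hM0, hf1]
  have hNb : N ^ b ≠ 0 := by simp [ENNReal.rpow_eq_zero_iff, hN0, hg1]
  have hMa' : M ^ a ≠ ⊤ := ENNReal.rpow_ne_top_of_nonneg ha.le hf1
  have hNb' : N ^ b ≠ ⊤ := ENNReal.rpow_ne_top_of_nonneg hb.le hg1
  have hMN : M ^ a * N ^ b ≠ 0 := mul_ne_zero hMa hNb
  have hMN' : M ^ a * N ^ b ≠ ⊤ := ENNReal.mul_ne_top hMa' hNb'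
  have key := lintegral_le_of_min_le (f := fun x => M⁻¹ * f x) (g := fun x => N⁻¹ * g x)
    (h := fun x => (M ^ a * N ^ b)⁻¹ * h x) (hf.const_mul _) (hg.const_mul _) (hh.const_mul _)
    (by rw [← ENNReal.mul_iSup, ENNReal.inv_mul_cancel hM0 hf1])
    (by rw [← ENNReal.mul_iSup, ENNReal.inv_mul_cancel hN0 hg1]) ha hb (fun x y => by
      calc _ = min (M⁻¹ * f x) (N⁻¹ * g y) ^ a * min (M⁻¹ * f x) (N⁻¹ * g y) ^ b := by
            rw [← ENNReal.rpow_add_of_nonneg _ _ ha.le hb.le, hab, ENNReal.rpow_one]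
        _ ≤ (M⁻¹ * f x) ^ a * (N⁻¹ * g y) ^ b := by
            gcongr
            · exact min_le_left _ _
            · exact min_le_right _ _
        _ = (M ^ a * N ^ b)⁻¹ * (f x ^ a * g y ^ b) := by
            rw [ENNReal.mul_rpow_of_nonneg _ _ ha.le, ENNReal.mul_rpow_of_nonneg _ _ hb.le,
              ENNReal.inv_rpow, ENNReal.inv_rpow, ENNReal.mul_inv (Or.inl hMa) (Or.inl hMa')]
            ring
        _ ≤ _ := by gcongr; exact H x y)
  rw [lintegral_const_mul _ hf, lintegral_const_mul _ hg, lintegral_const_mul _ hh] at key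
  have := (ENNReal.geom_mean_le_arith_mean2_weighted ha hb hab _ _).trans key
  rw [ENNReal.mul_rpow_of_nonneg _ _ ha.le, ENNReal.mul_rpow_of_nonneg _ _ hb.le,
    ENNReal.inv_rpow, ENNReal.inv_rpow] at this
  have e : (M ^ a)⁻¹ * (∫⁻ x, f x) ^ a * ((N ^ b)⁻¹ * (∫⁻ x, g x) ^ b)
      = (M ^ a * N ^ b)⁻¹ * ((∫⁻ x, f x) ^ a * (∫⁻ x, g x) ^ b) := by
    rw [ENNReal.mul_inv (Or.inl hMa) (Or.inl hMa')]; ring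
  rw [e] at this
  exact (ENNReal.mul_le_mul_iff_right (ENNReal.inv_ne_zero.2 hMN')
    (ENNReal.inv_ne_top.2 hMN)).1 this

/-- Prékopa–Leindler inequality on the line. -/
theorem prekopa_leindler_real {f g h : ℝ → ENNReal} (hf : Measurable f)
    (hg : Measurable g) (hh : Measurable h)
    {a b : ℝ} (ha : 0 < a) (hb : 0 < b) (hab : a + b = 1)
    (H : ∀ x y, f x ^ a * g y ^ b ≤ h (a * x + b * y)) :
    (∫⁻ x, f x) ^ a * (∫⁻ x, g x) ^ b ≤ ∫⁻ x, h x := by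
  rcases eq_or_ne (∫⁻ x, f x) 0 with h0 | hf0
  · simp [h0, ENNReal.zero_rpow_of_pos ha]
  rcases eq_or_ne (∫⁻ x, g x) 0 with h0 | hg0
  · simp [h0, ENNReal.zero_rpow_of_pos hb]
  have lim : ∀ {u : ℝ → ENNReal}, Measurable u →
      Filter.Tendsto (fun k : ℕ => ∫⁻ x, min (u x) k) Filter.atTop (nhds (∫⁻ x, u x)) := by
    intro u hu
    refine lintegral_tendsto_of_tendsto_of_monotone (fun k => (hu.min measurable_const).aemeasurable)
      (Filter.Eventually.of_forall fun x k l hkl => ?_) (Filter.Eventually.of_forall fun x => ?_)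
    · exact min_le_min_left _ (by exact_mod_cast hkl)
    · have := (tendsto_const_nhds (x := u x)).min ENNReal.tendsto_nat_nhds_top
      simpa using this
  have hlim := ENNReal.Tendsto.mul
    ((ENNReal.continuous_rpow_const (y := a)).continuousAt.tendsto.comp (lim hf))
    (Or.inl (by simp [ENNReal.rpow_eq_zero_iff, hf0, ha.not_gt]))
    ((ENNReal.continuous_rpow_const (y := b)).continuousAt.tendsto.comp (lim hg))
    (Or.inl (by simp [ENNReal.rpow_eq_zero_iff, hg0, hb.not_gt]))
  refine le_of_tendsto' hlim fun k => ?_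
  have hbd : ∀ u : ℝ → ENNReal, ⨆ x, min (u x) (k : ENNReal) ≠ ⊤ := fun u =>
    ((iSup_le fun x => min_le_right _ _).trans_lt (ENNReal.natCast_lt_top k)).ne
  refine prekopa_leindler_real_of_bounded (hf.min measurable_const) (hg.min measurable_const) hh
    (hbd f) (hbd g) ha hb hab fun x y => le_trans ?_ (H x y)
  gcongr <;> exact min_le_left _ _

/-- Prékopa–Leindler inequality. -/
theorem prekopa_leindler {n : ℕ} {f g h : (Fin n → ℝ) → ENNReal} (hf : Measurable f)
    (hg : Measurable g) (hh : Measurable h)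
    {a b : ℝ} (ha : 0 < a) (hb : 0 < b) (hab : a + b = 1)
    (H : ∀ x y, f x ^ a * g y ^ b ≤ h (a • x + b • y)) :
    (∫⁻ x, f x) ^ a * (∫⁻ x, g x) ^ b ≤ ∫⁻ x, h x := by
  induction n with
  | zero =>
    have h0 := H default default
    rw [Subsingleton.elim (a • default + b • default) (default : Fin 0 → ℝ)] at h0
    simp only [lintegral_unique, Measure.volume_pi_eq_dirac (default : Fin 0 → ℝ), measure_univ,
      mul_one]
    convert! h0
  | succ n ih =>
    let e := MeasurableEquiv.piFinSuccAbove (fun _ : Fin (n + 1) => ℝ) 0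
    have he : MeasurePreserving e.symm :=
      (volume_preserving_piFinSuccAbove (fun _ : Fin (n + 1) => ℝ) 0).symm e
    have meas : ∀ {u : (Fin (n + 1) → ℝ) → ENNReal}, Measurable u →
        Measurable fun p : ℝ × (Fin n → ℝ) => u (e.symm p) :=
      fun hu => hu.comp e.symm.measurable
    have fubini : ∀ {u : (Fin (n + 1) → ℝ) → ENNReal}, Measurable u →
        ∫⁻ x, u x = ∫⁻ s, ∫⁻ y, u (e.symm (s, y)) := fun {u} hu => by
      rw [← he.lintegral_comp hu, Measure.volume_eq_prod, lintegral_prod _ (meas hu).aemeasurable]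
    rw [fubini hf, fubini hg, fubini hh]
    refine prekopa_leindler_real (meas hf).lintegral_prod_right' (meas hg).lintegral_prod_right'
      (meas hh).lintegral_prod_right' ha hb hab fun s t => ?_
    refine ih ((meas hf).comp measurable_prodMk_left) ((meas hg).comp measurable_prodMk_left)
      ((meas hh).comp measurable_prodMk_left) fun x y => ?_
    refine (H _ _).trans_eq (congrArg h ?_)
    ext i
    refine Fin.cases ?_ (fun j => ?_) i <;>
      simp [e, MeasurableEquiv.piFinSuccAbove, Fin.insertNthEquiv]

/-- Multiplicative Brunn–Minkowski inequality. -/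
theorem volume_rpow_mul_volume_rpow_le {n : ℕ} {A B C : Set (Fin n → ℝ)} (hA : MeasurableSet A)
    (hB : MeasurableSet B) (hC : MeasurableSet C)
    {a b : ℝ} (ha : 0 < a) (hb : 0 < b) (hab : a + b = 1)
    (H : ∀ x ∈ A, ∀ y ∈ B, a • x + b • y ∈ C) :
    volume A ^ a * volume B ^ b ≤ volume C := by
  have := prekopa_leindler (f := A.indicator 1) (g := B.indicator 1) (h := C.indicator 1)
    (measurable_one.indicator hA) (measurable_one.indicator hB) (measurable_one.indicator hC)
    ha hb hab (fun x y => by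
      by_cases hx : x ∈ A
      · by_cases hy : y ∈ B
        · simp [hx, hy, H x hx y hy]
        · simp [hy, ENNReal.zero_rpow_of_pos hb]
      · simp [hx, ENNReal.zero_rpow_of_pos ha])
  simpa [lintegral_indicator_one, hA, hB, hC] using this

/-- A concave function on an open set has a supporting affine function at each point. -/
theorem ConcaveOn.exists_le_add_apply_sub {E : Type*} [NormedAddCommGroup E] [NormedSpace ℝ E]
    [FiniteDimensional ℝ E] {U : Set E} {φ : E → ℝ} (hφ : ConcaveOn ℝ U φ) (hU : IsOpen U)
    {x₀ : E} (hx₀ : x₀ ∈ U) : ∃ l : E →L[ℝ] ℝ, ∀ x ∈ U, φ x ≤ φ x₀ + l (x - x₀) := by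
  have hopen : IsOpen {p : E × ℝ | p.1 ∈ U ∧ p.2 < φ p.1} := by
    have hcont : ContinuousOn (fun p : E × ℝ => φ p.1 - p.2) (Prod.fst ⁻¹' U) :=
      ((hφ.continuousOn hU).comp continuousOn_fst fun _ h => h).sub continuousOn_snd
    convert! hcont.isOpen_inter_preimage (hU.preimage continuous_fst)
      (isOpen_Ioi (a := (0 : ℝ))) using 1
    ext p
    simp
  obtain ⟨l, hl⟩ := geometric_hahn_banach_open_point (x := (x₀, φ x₀))
    hφ.convex_strict_hypograph hopen (by simp)
  have split : ∀ x s, l (x, s) = l (x, 0) + s * l (0, 1) := fun x s => by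
    rw [← smul_eq_mul, ← map_smul, ← map_add]; simp
  have hc : 0 < l (0, 1) := by
    have := hl (x₀, φ x₀ - 1) ⟨hx₀, by simp⟩
    rw [split, split x₀ (φ x₀)] at this
    linarith
  refine ⟨-(l (0, 1))⁻¹ • l.comp (ContinuousLinearMap.inl ℝ E ℝ), fun x hx => ?_⟩
  refine le_of_forall_lt fun s hs => ?_
  have h1 := hl (x, s) ⟨hx, hs⟩
  have h2 : l (x - x₀, 0) = l (x, 0) - l (x₀, 0) := by rw [← map_sub]; simp
  rw [split, split x₀ (φ x₀)] at h1
  simp only [smul_apply, ContinuousLinearMap.comp_apply,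
    ContinuousLinearMap.inl_apply, smul_eq_mul, h2]
  have h3 : s < φ x₀ - (l (x, 0) - l (x₀, 0)) / l (0, 1) := by
    rw [lt_sub_iff_add_lt, ← lt_sub_iff_add_lt', div_lt_iff₀ hc]
    nlinarith
  rw [div_eq_inv_mul] at h3
  linarith

theorem zero_mem_interior_of_integral_eq_zero {n : ℕ} {K : Set (Fin n → ℝ)}
    (hK : IsCompact K) (hconv : Convex ℝ K) (hint : (interior K).Nonempty)
    (h0 : ∫ x in K, x = (0 : Fin n → ℝ)) : (0 : Fin n → ℝ) ∈ interior K := by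
  by_contra hn
  obtain ⟨l, hl⟩ := geometric_hahn_banach_open_point hconv.interior isOpen_interior hn
  rw [map_zero] at hl
  have hi : IntegrableOn (fun x => l x) K := l.continuous.continuousOn.integrableOn_compact hK
  have h1 : ∫ x in K, l x = 0 := by
    rw [l.integral_comp_comm (φ := fun x => x)
      (continuous_id.continuousOn.integrableOn_compact hK), h0, map_zero]
  rw [← setIntegral_congr_set (interior_ae_eq_of_null_frontier (hconv.addHaar_frontier volume))]
    at h1
  have h2 : 0 < ∫ x in interior K, -l x := by
    rw [setIntegral_pos_iff_support_of_nonneg_ae]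
    · refine (isOpen_interior.measure_pos volume hint).trans_le (measure_mono fun x hx => ⟨?_, hx⟩)
      simpa using (hl x hx).ne
    · filter_upwards [ae_restrict_mem isOpen_interior.measurableSet] with x hx
      simpa using (hl x hx).le
    · exact (hi.mono_set interior_subset).neg
  rw [integral_neg, h1] at h2
  simp at h2

/-- The set of points of `K` whose reflection in `y` lies in `K`. -/
def reflectionInter {E : Type*} [AddCommGroup E] [Module ℝ E] (K : Set E) (y : E) : Set E :=
  K ∩ {z | (2 : ℝ) • y - z ∈ K}

section reflectionInter

variable {n : ℕ} {K : Set (Fin n → ℝ)}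

theorem isCompact_reflectionInter (hK : IsCompact K) (y : Fin n → ℝ) :
    IsCompact (reflectionInter K y) :=
  hK.inter_right (hK.isClosed.preimage (by fun_prop))

theorem mem_of_mem_reflectionInter (hconv : Convex ℝ K) {y z : Fin n → ℝ}
    (hz : z ∈ reflectionInter K y) : y ∈ K := by
  have := hconv hz.1 hz.2 (by norm_num : (0 : ℝ) ≤ 1 / 2) (by norm_num : (0 : ℝ) ≤ 1 / 2)
    (by norm_num)
  convert! this using 1
  module

theorem volume_reflectionInter_pos {y : Fin n → ℝ} (hy : y ∈ interior K) :
    0 < volume (reflectionInter K y) := by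
  have hopen : IsOpen (interior K ∩ {z | (2 : ℝ) • y - z ∈ interior K}) :=
    isOpen_interior.inter (isOpen_interior.preimage (by fun_prop))
  refine (hopen.measure_pos volume ⟨y, hy, ?_⟩).trans_le (measure_mono ?_)
  · simpa [two_smul] using hy
  · exact fun z hz => ⟨interior_subset hz.1, interior_subset (s := K) hz.2⟩

theorem concaveOn_log_volume_reflectionInter (hK : IsCompact K) (hconv : Convex ℝ K) :
    ConcaveOn ℝ (interior K) fun y => Real.log (volume.real (reflectionInter K y)) := by
  refine concaveOn_iff_forall_pos.2 ⟨hconv.interior, fun x hx y hy a b ha hb hab => ?_⟩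
  have pos : ∀ {y}, y ∈ interior K → 0 < volume.real (reflectionInter K y) := fun {y} hy =>
    ENNReal.toReal_pos (volume_reflectionInter_pos hy).ne'
      (isCompact_reflectionInter hK y).measure_ne_top
  have h := volume_rpow_mul_volume_rpow_le (isCompact_reflectionInter hK x).measurableSet
    (isCompact_reflectionInter hK y).measurableSet
    (isCompact_reflectionInter hK (a • x + b • y)).measurableSet ha hb hab
    (fun u hu v hv => ⟨hconv hu.1 hv.1 ha.le hb.le hab, by
      have := hconv hu.2 hv.2 ha.le hb.le hab
      simp only [Set.mem_ofPred_eq]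
      convert! this using 1
      module⟩)
  have h' := ENNReal.toReal_mono (isCompact_reflectionInter hK (a • x + b • y)).measure_ne_top h
  rw [ENNReal.toReal_mul, ← ENNReal.toReal_rpow, ← ENNReal.toReal_rpow] at h'
  change volume.real (reflectionInter K x) ^ a * volume.real (reflectionInter K y) ^ b
    ≤ volume.real _ at h'
  have hxa := Real.rpow_pos_of_pos (pos hx) a
  have hyb := Real.rpow_pos_of_pos (pos hy) b
  have := Real.log_le_log (mul_pos hxa hyb) h'
  rwa [Real.log_mul hxa.ne' hyb.ne', Real.log_rpow (pos hx), Real.log_rpow (pos hy)] at this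

theorem integrable_indicator_reflectionInter (hK : IsCompact K) (hconv : Convex ℝ K)
    {φ : (Fin n → ℝ) → ℝ} (hφ : Continuous φ) :
    Integrable (fun p : (Fin n → ℝ) × (Fin n → ℝ) =>
      (reflectionInter K p.1).indicator (fun _ => φ p.1) p.2) := by
  set T : Set ((Fin n → ℝ) × (Fin n → ℝ)) := {p | p.2 ∈ reflectionInter K p.1} with hT
  have hTc : IsCompact T := by
    refine (hK.prod hK).of_isClosed_subset ?_
      fun p hp => ⟨mem_of_mem_reflectionInter hconv hp, hp.1⟩
    exact (hK.isClosed.preimage continuous_snd).inter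
      (hK.isClosed.preimage (f := fun p : (Fin n → ℝ) × (Fin n → ℝ) => (2 : ℝ) • p.1 - p.2)
        (by fun_prop))
  have : (fun p : (Fin n → ℝ) × (Fin n → ℝ) =>
      (reflectionInter K p.1).indicator (fun _ => φ p.1) p.2)
      = T.indicator fun p => φ p.1 := by
    rfl
  rw [this, integrable_indicator_iff hTc.measurableSet]
  exact (hφ.comp continuous_fst).continuousOn.integrableOn_compact hTc

theorem integral_indicator_reflectionInter (hK : IsCompact K) (y : Fin n → ℝ) (c : ℝ) :
    ∫ z, (reflectionInter K y).indicator (fun _ => c) z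
      = volume.real (reflectionInter K y) * c := by
  rw [integral_indicator_const _ (isCompact_reflectionInter hK y).measurableSet, smul_eq_mul]

theorem integrable_volume_reflectionInter_mul (hK : IsCompact K) (hconv : Convex ℝ K)
    {φ : (Fin n → ℝ) → ℝ} (hφ : Continuous φ) :
    Integrable fun y => volume.real (reflectionInter K y) * φ y := by
  simpa only [integral_indicator_reflectionInter hK] using
    (integrable_indicator_reflectionInter hK hconv hφ).integral_prod_left

theorem integral_volume_reflectionInter_mul (hK : IsCompact K) (hconv : Convex ℝ K)
    {φ : (Fin n → ℝ) → ℝ} (hφ : Continuous φ) :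
    ∫ y, volume.real (reflectionInter K y) * φ y
      = ∫ z in K, (2 ^ n)⁻¹ * ∫ w in K, φ ((1 / 2 : ℝ) • (w + z)) := by
  simp_rw [← integral_indicator_reflectionInter hK]
  rw [integral_integral_swap (integrable_indicator_reflectionInter hK hconv hφ),
    ← integral_indicator hK.measurableSet]
  refine integral_congr_ae (Filter.Eventually.of_forall fun z => ?_)
  by_cases hz : z ∈ K
  · have e1 : ∀ y, (reflectionInter K y).indicator (fun _ => φ y) z
        = (fun u => K.indicator (fun w => φ ((1 / 2 : ℝ) • (w + z))) (u - z)) ((2 : ℝ) • y) := by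
      intro y
      have hiff : z ∈ reflectionInter K y ↔ (2 : ℝ) • y - z ∈ K := and_iff_right hz
      by_cases h : (2 : ℝ) • y - z ∈ K
      · simp only [Set.indicator_of_mem (hiff.2 h), Set.indicator_of_mem h]
        congr 1
        module
      · simp [mt hiff.1 h, h]
    simp only [Set.indicator_of_mem hz]
    rw [integral_congr_ae (Filter.Eventually.of_forall e1), Measure.integral_comp_smul volume
        (fun u => K.indicator (fun w => φ ((1 / 2 : ℝ) • (w + z))) (u - z)) 2,
      integral_sub_right_eq_self (fun u => K.indicator (fun w => φ ((1 / 2 : ℝ) • (w + z))) u),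
      integral_indicator hK.measurableSet]
    simp
  · simp [reflectionInter, hz]

/-- The Milman–Pajor inequality: a convex body with centroid at the origin has
`vol (K ∩ -K) ≥ 2⁻ⁿ vol K`. -/
theorem volume_le_two_pow_mul_volume_inter_neg (hK : IsCompact K) (hconv : Convex ℝ K)
    (hint : (interior K).Nonempty) (hcent : ∫ x in K, x = (0 : Fin n → ℝ)) :
    volume.real K ≤ 2 ^ n * volume.real (K ∩ -K) := by
  have h0 := zero_mem_interior_of_integral_eq_zero hK hconv hint hcent
  have hVpos : 0 < volume.real K := ENNReal.toReal_pos
    ((isOpen_interior.measure_pos volume hint).trans_le (measure_mono interior_subset)).ne'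
    hK.measure_ne_top
  have pos : ∀ {y}, y ∈ interior K → 0 < volume.real (reflectionInter K y) := fun {y} hy =>
    ENNReal.toReal_pos (volume_reflectionInter_pos hy).ne'
      (isCompact_reflectionInter hK y).measure_ne_top
  obtain ⟨l, hl⟩ := (concaveOn_log_volume_reflectionInter hK hconv).exists_le_add_apply_sub
    isOpen_interior h0
  set F : (Fin n → ℝ) → ℝ := fun y => volume.real (reflectionInter K y) with hF
  set V := volume.real K with hV
  set m : ℝ := (2 ^ n)⁻¹ * V with hm
  have hmpos : 0 < m := by positivity
  set c : ℝ := Real.log m + 1 - Real.log (F 0) with hc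
  have hcont : Continuous fun y => c - l y := by fun_prop
  have hle : ∫ y in K, F y * (c - l y) ≤ m * V := by
    have hae := interior_ae_eq_of_null_frontier (hconv.addHaar_frontier volume)
    calc ∫ y in K, F y * (c - l y) = ∫ y in interior K, F y * (c - l y) :=
          (setIntegral_congr_set hae).symm
      _ ≤ ∫ y in interior K, m := by
          refine setIntegral_mono_on
            (integrable_volume_reflectionInter_mul hK hconv hcont).integrableOn
            (integrableOn_const ((measure_mono interior_subset).trans_lt hK.measure_lt_top).ne)
            isOpen_interior.measurableSet fun y hy => ?_
          have hy1 := hl y hy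
          have hFy : 0 < F y := pos hy
          have h1 := Real.log_le_sub_one_of_pos (div_pos hmpos hFy)
          rw [Real.log_div hmpos.ne' hFy.ne'] at h1
          have h2 : c - l y ≤ m / F y := by
            simp only [sub_zero] at hy1
            simp only [hc, hF] at h1 ⊢
            linarith
          calc F y * (c - l y) ≤ F y * (m / F y) := by gcongr
            _ = m := by field_simp
      _ = m * V := by
          rw [setIntegral_congr_set hae, setIntegral_const, smul_eq_mul, mul_comm]
  have heq : ∫ y in K, F y * (c - l y) = m * V * c := by
    rw [setIntegral_eq_integral_of_forall_compl_eq_zero,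
      integral_volume_reflectionInter_mul hK hconv hcont]
    · have hid : IntegrableOn (fun x : Fin n → ℝ => x) K :=
        continuous_id.continuousOn.integrableOn_compact hK
      have hl0 : ∫ x in K, l x = 0 := by rw [l.integral_comp_comm hid, hcent, map_zero]
      have hli : IntegrableOn (fun x => l x) K := l.continuous.continuousOn.integrableOn_compact hK
      have hconst : ∀ r : ℝ, IntegrableOn (fun _ : Fin n → ℝ => r) K := fun r =>
        integrableOn_const hK.measure_ne_top
      have haff : ∀ r s : ℝ, ∫ x in K, (r - s * l x) = V * r := fun r s => by
        rw [integral_sub (hconst r) (hli.const_mul s), integral_const_mul, hl0,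
          setIntegral_const, smul_eq_mul, mul_zero, sub_zero]
      have inner : ∀ z, ∫ w in K, (c - l ((1 / 2 : ℝ) • (w + z))) = V * (c - 1 / 2 * l z) := by
        intro z
        rw [← haff _ (1 / 2)]
        congr 1 with w
        simp only [map_smul, map_add, smul_eq_mul]
        ring
      simp_rw [inner]
      rw [integral_const_mul, integral_const_mul, haff, hm]
      ring
    · intro y hy
      have : reflectionInter K y = ∅ :=
        Set.eq_empty_iff_forall_notMem.2 fun z hz => hy (mem_of_mem_reflectionInter hconv hz)
      simp [hF, this]
  rw [heq] at hle
  have hc1 : c ≤ 1 := by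
    by_contra! h
    nlinarith [mul_pos hmpos hVpos]
  have hlog : Real.log m ≤ Real.log (F 0) := by linarith
  have hmF : m ≤ F 0 := (Real.log_le_log_iff hmpos (pos h0)).1 hlog
  have hF0 : F 0 = volume.real (K ∩ -K) := by
    simp only [hF]
    congr 1
    ext z
    simp [reflectionInter]
  rw [hF0, hm, inv_mul_le_iff₀ (by positivity)] at hmF
  exact hmF

end reflectionInter

/-- Volume bound on the size of an `(ε / 2) • (K ∩ -K)`-separated family in `K`. -/
theorem card_le_of_separated {n : ℕ} {K : Set (Fin n → ℝ)} (hK : IsCompact K)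
    (hconv : Convex ℝ K) (hint : (interior K).Nonempty)
    (hcent : ∫ x in K, x = (0 : Fin n → ℝ)) {ε : ℝ} (hε0 : 0 < ε) (hε1 : ε < 1)
    {N : ℕ} {p : Fin N → Fin n → ℝ} (hp : ∀ i, p i ∈ K)
    (hsep : ∀ i j, i ≠ j → p i - p j ∉ (ε / 2) • (K ∩ -K)) :
    (N : ℝ) ≤ (10 / ε) ^ n := by
  set S := K ∩ -K with hS
  have hSc : IsCompact S := hK.inter_right hK.neg.isClosed
  have hSconv : Convex ℝ S := hconv.inter hconv.neg
  have hSneg : ∀ x ∈ S, -x ∈ S := fun x hx => ⟨hx.2, by simpa using hx.1⟩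
  have hMP := volume_le_two_pow_mul_volume_inter_neg hK hconv hint hcent
  have hVpos : 0 < volume.real K := ENNReal.toReal_pos
    ((isOpen_interior.measure_pos volume hint).trans_le (measure_mono interior_subset)).ne'
    hK.measure_ne_top
  have hSpos : 0 < volume.real S := by
    by_contra! h
    nlinarith [pow_pos (two_pos (α := ℝ)) n]
  have hδ : 0 < ε / 4 := by positivity
  have hdisj : Pairwise (Function.onFun Disjoint fun i => p i +ᵥ (ε / 4) • S) := by
    intro i j hij
    refine Set.disjoint_left.2 ?_
    rintro _ ⟨_, ⟨s, hs, rfl⟩, rfl⟩ ⟨_, ⟨t, ht, rfl⟩, h⟩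
    refine hsep i j hij ⟨(1 / 2 : ℝ) • t + (1 / 2 : ℝ) • (-s),
      hSconv ht (hSneg s hs) (by norm_num) (by norm_num) (by norm_num), ?_⟩
    simp only [vadd_eq_add] at h ⊢
    have : p i - p j = (ε / 4) • t - (ε / 4) • s := by
      rw [sub_eq_sub_iff_add_eq_add, ← h]; abel
    rw [this]
    module
  have hcompact : ∀ i, IsCompact (p i +ᵥ (ε / 4) • S) := fun i => (hSc.smul _).vadd _
  have hsub : ⋃ i, (p i +ᵥ (ε / 4) • S) ⊆ (1 + ε / 4) • K := by
    refine Set.iUnion_subset fun i => ?_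
    rw [hconv.add_smul zero_le_one hδ.le, one_smul]
    rintro _ ⟨_, ⟨s, hs, rfl⟩, rfl⟩
    exact Set.add_mem_add (hp i) (Set.smul_mem_smul_set hs.1)
  have hvol := measureReal_mono (μ := volume) hsub (hK.smul _).measure_ne_top
  rw [measureReal_iUnion_fintype hdisj (fun i => (hcompact i).measurableSet)
    (fun i => (hcompact i).measure_ne_top)] at hvol
  simp only [measureReal_def, measure_vadd, Measure.addHaar_smul_of_nonneg _ hδ.le,
    Measure.addHaar_smul_of_nonneg volume (by positivity : 0 ≤ 1 + ε / 4), ENNReal.toReal_mul,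
    Finset.sum_const, Finset.card_univ, Fintype.card_fin, nsmul_eq_mul,
    Module.finrank_fintype_fun_eq_card] at hvol
  rw [ENNReal.toReal_ofReal (by positivity), ENNReal.toReal_ofReal (by positivity)] at hvol
  simp only [← measureReal_def] at hvol
  have h1 : (N : ℝ) * (ε / 4) ^ n * volume.real S
      ≤ ((1 + ε / 4) * 2) ^ n * volume.real S := by
    calc _ ≤ (1 + ε / 4) ^ n * volume.real K := by rw [mul_assoc]; exact hvol
      _ ≤ (1 + ε / 4) ^ n * (2 ^ n * volume.real S) := by gcongr
      _ = _ := by rw [mul_pow]; ring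
  have h2 := le_of_mul_le_mul_right h1 hSpos
  rw [← le_div_iff₀ (by positivity), ← div_pow] at h2
  refine h2.trans (pow_le_pow_left₀ (by positivity) ?_ n)
  rw [div_le_div_iff₀ hδ hε0]
  nlinarith

/-- Any convex body `K ⊆ ℝⁿ` with centroid at the origin admits, for any `ε ∈ (0,1)`, a
symmetric `(2,ε)`-covering by at most `(10/ε)^n` translates of `(ε/2)(K ∩ -K)`. -/
theorem stmt_1 (n : ℕ) (K : Set (Fin n → ℝ))
    (hK_compact : IsCompact K) (hK_convex : Convex ℝ K)
    (hK_int : (interior K).Nonempty)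
    (hK_centroid : (∫ x in K, x) = (0 : Fin n → ℝ))
    (ε : ℝ) (hε0 : 0 < ε) (hε1 : ε < 1) :
    ∃ (N : ℕ) (p : Fin N → (Fin n → ℝ)),
      (N : ℝ) ≤ (10 / ε) ^ n ∧
      (∀ i, p i ∈ K) ∧
      K ⊆ ⋃ i, p i +ᵥ (ε / 2) • (K ∩ -K) ∧
      (∀ i, p i +ᵥ ε • (K ∩ -K) ⊆ (1 + ε) • K) := by

  set S := K ∩ -K with hS
  have hSneg : ∀ x ∈ S, -x ∈ S := fun x hx => ⟨hx.2, by simpa using hx.1⟩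
  have hmax : ∃ (N : ℕ) (p : Fin N → Fin n → ℝ), (∀ i, p i ∈ K) ∧
      (∀ i j, i ≠ j → p i - p j ∉ (ε / 2) • S) ∧ K ⊆ ⋃ i, p i +ᵥ (ε / 2) • S := by
    by_contra! hno
    have hall : ∀ N : ℕ, ∃ p : Fin N → Fin n → ℝ, (∀ i, p i ∈ K) ∧
        (∀ i j, i ≠ j → p i - p j ∉ (ε / 2) • S) := by
      intro N
      induction N with
      | zero => exact ⟨Fin.elim0, fun i => i.elim0, fun i => i.elim0⟩
      | succ N ih =>
        obtain ⟨p, hp, hsep⟩ := ih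
        obtain ⟨x, hxK, hx⟩ := Set.not_subset.1 (hno N p hp hsep)
        have hx' : ∀ i, x - p i ∉ (ε / 2) • S := fun i hi =>
          hx (Set.mem_iUnion.2 ⟨i, x - p i, hi, by simp⟩)
        refine ⟨Fin.cons x p, Fin.cases hxK hp, fun i j => ?_⟩
        refine Fin.cases (Fin.cases (fun h => (h rfl).elim) (fun j _ => ?_) j)
          (fun i => Fin.cases (fun _ => ?_) (fun j h => ?_) j) i
        · simpa using hx' j
        · rintro ⟨s, hs, h⟩
          refine hx' i ⟨-s, hSneg s hs, ?_⟩
          simp only [Fin.cons_succ, Fin.cons_zero] at h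
          simp [h]
        · simpa using hsep i j fun e => h (congrArg _ e)
    obtain ⟨N, hN⟩ := exists_nat_gt ((10 / ε) ^ n)
    obtain ⟨p, hp, hsep⟩ := hall N
    exact hN.not_ge
      (card_le_of_separated hK_compact hK_convex hK_int hK_centroid hε0 hε1 hp hsep)
  obtain ⟨N, p, hp, hsep, hcov⟩ := hmax
  refine ⟨N, p, card_le_of_separated hK_compact hK_convex hK_int hK_centroid hε0 hε1 hp hsep,
    hp, hcov, fun i => ?_⟩
  rw [hK_convex.add_smul zero_le_one hε0.le, one_smul]
  rintro _ ⟨_, ⟨s, hs, rfl⟩, rfl⟩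
  exact Set.add_mem_add (hp i) (Set.smul_mem_smul_set hs.1)
end

section
/- Let ε ∈ (0,1), let Q ⊆ ℝⁿ and let c ∈ ℝⁿ satisfy ‖c‖₂ ≤ 1+ε and ‖2x − c‖₂ ≤ 1+ε for every x ∈ Q. Then every p ∈ Q with ‖p‖₂ = 1 satisfies ⟨p, c⟩ ≥ 1−ε and ‖p − c‖₂² ≤ 5ε. (In particular, if Q is a member of a (2,ε)-covering of the Euclidean unit ball with centroid c, then Q ∩ S^{n−1} is contained in the Euclidean ball of radius √(5ε) centered at c.) -/
open scoped RealInnerProductSpace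

/-- If `‖c‖ ≤ 1+ε` and the homothet of `Q` by factor `2` about `c` lies in `(1+ε)B₂ⁿ`
(i.e. `‖2x - c‖ ≤ 1+ε` for all `x ∈ Q`), then every unit vector `p ∈ Q` satisfies
`⟨p,c⟩ ≥ 1-ε` and `‖p - c‖² ≤ 5ε`. -/
theorem stmt_6 (n : ℕ) (ε : ℝ) (hε0 : 0 < ε) (hε1 : ε < 1)
    (Q : Set (EuclideanSpace ℝ (Fin n))) (c : EuclideanSpace ℝ (Fin n))
    (hc : ‖c‖ ≤ 1 + ε) (hQ : ∀ x ∈ Q, ‖(2 : ℝ) • x - c‖ ≤ 1 + ε) :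
    ∀ p ∈ Q, ‖p‖ = 1 → 1 - ε ≤ ⟪p, c⟫ ∧ ‖p - c‖ ^ 2 ≤ 5 * ε := by
  intro p hp hp1
  have h2 := hQ p hp
  constructor
  · have h := real_inner_le_norm p ((2 : ℝ) • p - c)
    rw [inner_sub_right, real_inner_smul_right, real_inner_self_eq_norm_sq, hp1] at h
    linarith
  · have h := parallelogram_law_with_norm ℝ p (p - c)
    rw [show p + (p - c) = (2 : ℝ) • p - c by rw [two_smul]; abel, sub_sub_cancel, hp1] at h
    have h3 := mul_self_le_mul_self (norm_nonneg _) h2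
    have h4 := mul_self_le_mul_self (norm_nonneg _) hc
    nlinarith
end

section
/- There exists a constant c > 0 such that the following holds for every n ≥ 1: let K ⊆ ℝⁿ be an origin-symmetric convex body, let C, q > 1 be such that its modulus of smoothness satisfies ρ_K(τ) ≤ C·τ^q for all τ ∈ (0,1), and let ε ∈ (0, (8·C^{1/q})^{−q/(q−1)}]. Then there exist N ≤ 2^{c·n}·(1 + log₂(1/ε))·(C/ε)^{n/q} points c_1,…,c_N ∈ ℝⁿ and origin-symmetric convex bodies S_1,…,S_N with K ⊆ ⋃_{j=1}^N (c_j + S_j) and c_j + 2S_j ⊆ (1+ε)K for every j; i.e., K admits a symmetric (2,ε)-covering of that size. -/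
open Pointwise

open MeasureTheory in
/-- A `τ`-separated subset of the unit ball `K` of a seminorm has at most `(3 / τ) ^ n` points. -/
theorem card_le_of_separated_s7 {n : ℕ} {K : Set (Fin n → ℝ)} {p : Seminorm ℝ (Fin n → ℝ)}
    (hpK : ∀ x, x ∈ K ↔ p x ≤ 1) (hK : MeasurableSet K) (hK0 : volume K ≠ 0)
    (hK1 : volume K ≠ ⊤) {τ : ℝ} (hτ : 0 < τ) (hτ1 : τ ≤ 1) (A : Finset (Fin n → ℝ))
    (hA : ∀ a ∈ A, p a = 1) (hsep : ∀ a ∈ A, ∀ b ∈ A, a ≠ b → τ < p (b - a)) :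
    (A.card : ℝ) ≤ (3 / τ) ^ n := by
  have hsm : ∀ {s : ℝ}, 0 < s → ∀ x, x ∈ s • K ↔ p x ≤ s := by
    intro s hs x
    rw [Set.mem_smul_set_iff_inv_smul_mem₀ hs.ne', hpK, map_smul_eq_mul, norm_inv,
      Real.norm_of_nonneg hs.le, inv_mul_le_iff₀ hs, mul_one]
  have hvol : ∀ {s : ℝ}, 0 < s → volume (s • K) = ENNReal.ofReal (s ^ n) * volume K := by
    intro s hs
    rw [Measure.addHaar_smul, Module.finrank_fin_fun, abs_of_pos (pow_pos hs n)]
  have hdisj : (A : Set (Fin n → ℝ)).PairwiseDisjoint fun a => a +ᵥ (τ / 2) • K := by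
    intro a ha b hb hab
    rw [Function.onFun, Set.disjoint_left]
    intro x hxa hxb
    rw [Set.mem_vadd_set_iff_neg_vadd_mem, hsm (by positivity), vadd_eq_add] at hxa hxb
    have h1 := map_sub_le_add p (-a + x) (-b + x)
    rw [show -a + x - (-b + x) = b - a by abel] at h1
    linarith [hsep a ha b hb hab]
  have hsub : (⋃ a ∈ A, a +ᵥ (τ / 2) • K) ⊆ (1 + τ / 2) • K := by
    intro x hx
    simp only [Set.mem_iUnion] at hx
    obtain ⟨a, ha, hx⟩ := hx
    rw [Set.mem_vadd_set_iff_neg_vadd_mem, hsm (by positivity), vadd_eq_add] at hx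
    rw [hsm (by positivity)]
    have h1 := map_add_le_add p a (-a + x)
    rw [add_neg_cancel_left] at h1
    linarith [hA a ha]
  have hmeas := measure_mono (μ := volume) hsub
  rw [measure_biUnion_finset hdisj
    fun a _ => (hK.const_smul_of_ne_zero (by positivity)).const_vadd a] at hmeas
  simp only [measure_vadd] at hmeas
  rw [Finset.sum_const, nsmul_eq_mul, hvol (by positivity), hvol (by positivity), ← mul_assoc,
    ENNReal.mul_le_mul_iff_left hK0 hK1, ← ENNReal.ofReal_natCast,
    ← ENNReal.ofReal_mul (by positivity), ENNReal.ofReal_le_ofReal_iff (by positivity)] at hmeas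
  calc (A.card : ℝ) ≤ (1 + τ / 2) ^ n / (τ / 2) ^ n := by rwa [le_div_iff₀ (by positivity)]
    _ = ((1 + τ / 2) / (τ / 2)) ^ n := (div_pow _ _ _).symm
    _ ≤ (3 / τ) ^ n := by
      gcongr ?_ ^ n
      rw [div_le_div_iff₀ (by positivity) hτ]
      nlinarith

/-- A set whose finite `τ`-separated subsets have bounded cardinality has a finite `τ`-net
obeying the same bound. -/
theorem exists_net_of_card_le {E : Type*} [AddCommGroup E] [Module ℝ E] (p : Seminorm ℝ E)
    (X : Set E) {τ B : ℝ} (hτ : 0 ≤ τ)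
    (h : ∀ A : Finset E, (∀ a ∈ A, a ∈ X) →
      (∀ a ∈ A, ∀ b ∈ A, a ≠ b → τ < p (b - a)) → (A.card : ℝ) ≤ B) :
    ∃ A : Finset E, (∀ a ∈ A, a ∈ X) ∧ (A.card : ℝ) ≤ B ∧
      ∀ x ∈ X, ∃ a ∈ A, p (x - a) ≤ τ := by
  classical
  let P : ℕ → Prop := fun k => ∃ A : Finset E, (∀ a ∈ A, a ∈ X) ∧
    (∀ a ∈ A, ∀ b ∈ A, a ≠ b → τ < p (b - a)) ∧ A.card = k
  have hbd : ∀ k, P k → k ≤ ⌊B⌋₊ := by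
    rintro k ⟨A, hAX, hA, rfl⟩
    exact Nat.le_floor (h A hAX hA)
  have h0 : P 0 := ⟨∅, by simp, by simp, rfl⟩
  obtain ⟨A, hAX, hA, hcard⟩ := Nat.findGreatest_spec (P := P) (Nat.zero_le ⌊B⌋₊) h0
  refine ⟨A, hAX, h A hAX hA, fun x hx => ?_⟩
  by_contra! hfar
  have hxA : x ∉ A := fun hxA => by
    have := hfar x hxA
    rw [sub_self, map_zero] at this
    linarith
  have hP : P (A.card + 1) := by
    refine ⟨insert x A, ?_, ?_, Finset.card_insert_of_notMem hxA⟩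
    · intro a ha
      rcases Finset.mem_insert.1 ha with rfl | ha
      exacts [hx, hAX a ha]
    · intro a ha b hb hab
      rw [Finset.mem_insert] at ha hb
      rcases ha with rfl | ha <;> rcases hb with rfl | hb
      · exact absurd rfl hab
      · rw [map_sub_rev]
        exact hfar b hb
      · exact hfar a ha
      · exact hA a ha b hb hab
  have := Nat.le_findGreatest (hbd _ hP) hP
  omega

section Smooth

variable {E : Type*} [AddCommGroup E] [Module ℝ E] {p : Seminorm ℝ E} {C q : ℝ}

/-- In a uniformly smooth seminorm, the line through two nearby unit vectors stays close to the
unit sphere outside the segment between them. -/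
theorem seminorm_line_le
    (hsm : ∀ x s, p x = 1 → p s < 1 → p (x + s) + p (x - s) ≤ 2 + 2 * (C * p s ^ q))
    {u v : E} (hu : p u = 1) (hv : p v = 1) {t : ℝ} (ht : 1 ≤ t) (htv : t * p (v - u) < 1) :
    p (u + t • (v - u)) ≤ 1 + 2 * (C * (t * p (v - u)) ^ q) ∧
      p (u - t • (v - u)) ≤ 1 + 2 * (C * (t * p (v - u)) ^ q) := by
  have ht0 : 0 ≤ t := by linarith
  have hps : p (t • (v - u)) = t * p (v - u) := by
    rw [map_smul_eq_mul, Real.norm_of_nonneg ht0]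
  have h := hsm u (t • (v - u)) hu (by rwa [hps])
  rw [hps] at h
  have h1 : 1 ≤ p (u - t • (v - u)) := by
    have := map_add_le_add p (u - t • (v - u)) (t • v)
    rw [show u - t • (v - u) + t • v = (1 + t) • u by module, map_smul_eq_mul, map_smul_eq_mul,
      Real.norm_of_nonneg ht0, Real.norm_of_nonneg (by linarith), hu, hv] at this
    linarith
  have h2 : 1 ≤ p (u + t • (v - u)) := by
    have := map_add_le_add p (u + t • (v - u)) ((t - 1) • u)
    rw [show u + t • (v - u) + (t - 1) • u = t • v by module, map_smul_eq_mul, map_smul_eq_mul,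
      Real.norm_of_nonneg ht0, Real.norm_of_nonneg (by linarith), hu, hv] at this
    linarith
  constructor <;> linarith

/-- If the directions `u`, `v` are `τ`-close and the depths of `r • u` and `ρ • v` below the
sphere of radius `1 + ε` are comparable, then `ρ • v` lies in the largest body centred at `r • u`
whose double stays in the ball of radius `1 + ε`. -/
theorem seminorm_double_le
    (hsm : ∀ x s, p x = 1 → p s < 1 → p (x + s) + p (x - s) ≤ 2 + 2 * (C * p s ^ q))
    (hC : 0 ≤ C) (hq : 0 ≤ q) {u v : E} (hu : p u = 1) (hv : p v = 1) {τ ε r ρ : ℝ}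
    (hτ : p (v - u) ≤ τ) (hτ1 : 3 * τ < 1) (hε1 : ε ≤ 1 / 8)
    (hη : 2 * (C * (3 * τ) ^ q) ≤ ε / 4) (hρ : 1 / 2 ≤ ρ) (hρr : ρ ≤ r) (hr : r ≤ 1)
    (hrρ : 1 + ε - ρ ≤ 5 / 4 * (1 + ε - r)) :
    p (r • u + (2 : ℝ) • (ρ • v - r • u)) ≤ 1 + ε ∧
      p (r • u - (2 : ℝ) • (ρ • v - r • u)) ≤ 1 + ε := by
  have hw : 0 ≤ p (v - u) := apply_nonneg p _
  have key : ∀ t : ℝ, 1 ≤ t → t ≤ 3 → p (u + t • (v - u)) ≤ 1 + ε / 4 ∧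
      p (u - t • (v - u)) ≤ 1 + ε / 4 := by
    intro t h1 h3
    have hle : t * p (v - u) ≤ 3 * τ := mul_le_mul h3 hτ hw (by norm_num)
    have hpow : C * (t * p (v - u)) ^ q ≤ C * (3 * τ) ^ q := by gcongr
    have := seminorm_line_le hsm hu hv h1 (by linarith)
    constructor <;> linarith
  have ha : 0 < 2 * ρ - r := by linarith
  have hb : 0 < 3 * r - 2 * ρ := by linarith
  have h1 := (key (2 * ρ / (2 * ρ - r)) (by rw [le_div_iff₀ ha]; linarith)
    (by rw [div_le_iff₀ ha]; linarith)).1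
  have h2 := (key (2 * ρ / (3 * r - 2 * ρ)) (by rw [le_div_iff₀ hb]; linarith)
    (by rw [div_le_iff₀ hb]; linarith)).2
  have e1 : r • u + (2 : ℝ) • (ρ • v - r • u) =
      (2 * ρ - r) • (u + (2 * ρ / (2 * ρ - r)) • (v - u)) := by
    rw [smul_add, smul_smul, mul_div_cancel₀ _ ha.ne']
    module
  have e2 : r • u - (2 : ℝ) • (ρ • v - r • u) =
      (3 * r - 2 * ρ) • (u - (2 * ρ / (3 * r - 2 * ρ)) • (v - u)) := by
    rw [smul_sub (3 * r - 2 * ρ), smul_smul (3 * r - 2 * ρ), mul_div_cancel₀ _ hb.ne']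
    module
  rw [e1, e2, map_smul_eq_mul, map_smul_eq_mul, Real.norm_of_nonneg ha.le,
    Real.norm_of_nonneg hb.le]
  constructor
  · nlinarith
  · nlinarith

end Smooth

/-- Points `ε ≤ D ≤ 1` are within a factor `5 / 4` of `O(log (1 / ε))` geometric scales. -/
theorem exists_scale {ε D : ℝ} (hε : 0 < ε) (hD : ε ≤ D) (hD1 : D ≤ 1) :
    ∃ i < ⌊4 * Real.logb 2 (1 / ε)⌋₊ + 1, ε * (5 / 4) ^ i ≤ D ∧ D ≤ 5 / 4 * (ε * (5 / 4) ^ i) := by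
  obtain ⟨i, hi, hi'⟩ := exists_nat_pow_near ((one_le_div hε).2 hD)
    (by norm_num : (1 : ℝ) < 5 / 4)
  rw [le_div_iff₀ hε] at hi
  rw [div_lt_iff₀ hε] at hi'
  refine ⟨i, Nat.lt_succ_of_le (Nat.le_floor ?_), by linarith, by rw [pow_succ] at hi'; linarith⟩
  have h1 : (2 : ℝ) ^ i ≤ (1 / ε) ^ 4 := by
    calc (2 : ℝ) ^ i ≤ ((5 / 4) ^ 4) ^ i := by gcongr; norm_num
      _ = ((5 / 4) ^ i) ^ 4 := by rw [← pow_mul, ← pow_mul, mul_comm]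
      _ ≤ (1 / ε) ^ 4 := by
        gcongr
        rw [le_div_iff₀ hε]
        linarith
  have h2 := Real.logb_le_logb_of_le (b := 2) (by norm_num) (by positivity) h1
  rw [Real.logb_pow, Real.logb_pow, Real.logb_self_eq_one (by norm_num)] at h2
  simpa using h2

/-- The symmetric convex body `{s | p (a ± 2 s) ≤ R}`, for a seminorm `p` with compact unit
ball `K`. -/
theorem symmetric_body {n : ℕ} {p : Seminorm ℝ (Fin n → ℝ)} {K : Set (Fin n → ℝ)}
    (hpK : ∀ x, x ∈ K ↔ p x ≤ 1) (hK : IsCompact K) (hcont : Continuous p)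
    {a : Fin n → ℝ} {R : ℝ} (ha : p a < R) :
    let S := {s | p (a + (2 : ℝ) • s) ≤ R ∧ p (a - (2 : ℝ) • s) ≤ R}
    IsCompact S ∧ Convex ℝ S ∧ (interior S).Nonempty ∧ S = -S := by
  intro S
  have hR : 0 < R := (apply_nonneg p a).trans_lt ha
  have hc1 : Continuous fun s : Fin n → ℝ => p (a + (2 : ℝ) • s) := by fun_prop
  have hc2 : Continuous fun s : Fin n → ℝ => p (a - (2 : ℝ) • s) := by fun_prop
  have hsymm : ∀ s, -s ∈ S ↔ s ∈ S := by
    intro s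
    simp only [S, Set.mem_ofPred_eq, smul_neg, sub_neg_eq_add, ← sub_eq_add_neg]
    exact and_comm
  refine ⟨?_, ?_, ?_, ?_⟩
  · refine (hK.smul R).of_isClosed_subset
      ((isClosed_le hc1 continuous_const).inter (isClosed_le hc2 continuous_const)) ?_
    rintro s ⟨h1, h2⟩
    rw [Set.mem_smul_set_iff_inv_smul_mem₀ hR.ne', hpK, map_smul_eq_mul, norm_inv,
      Real.norm_of_nonneg hR.le, inv_mul_le_iff₀ hR, mul_one]
    have h3 := map_sub_le_add p (a + (2 : ℝ) • s) (a - (2 : ℝ) • s)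
    rw [show a + (2 : ℝ) • s - (a - (2 : ℝ) • s) = (4 : ℝ) • s by module, map_smul_eq_mul,
      Real.norm_of_nonneg (by norm_num)] at h3
    have := apply_nonneg p s
    linarith
  · rintro x ⟨hx1, hx2⟩ y ⟨hy1, hy2⟩ b c hb hc hbc
    have hconv : ∀ z w, p z ≤ R → p w ≤ R → p (b • z + c • w) ≤ R := by
      intro z w hz hw
      calc p (b • z + c • w) ≤ b * p z + c * p w := by
            simpa [map_smul_eq_mul, abs_of_nonneg hb, abs_of_nonneg hc] using
              map_add_le_add p (b • z) (c • w)
        _ ≤ b * R + c * R := by gcongr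
        _ = R := by rw [← add_mul, hbc, one_mul]
    obtain rfl : c = 1 - b := by linarith
    constructor
    · convert hconv _ _ hx1 hy1 using 2
      module
    · convert hconv _ _ hx2 hy2 using 2
      module
  · refine ⟨0, mem_interior.2 ⟨{s | p (a + (2 : ℝ) • s) < R} ∩ {s | p (a - (2 : ℝ) • s) < R},
      fun s hs => ⟨hs.1.le, hs.2.le⟩,
      (isOpen_lt hc1 continuous_const).inter (isOpen_lt hc2 continuous_const), ?_⟩⟩
    simpa using ha
  · ext s
    rw [Set.mem_neg, hsymm]

/-- The separation `τ = (ε / (8 C)) ^ (1 / q) / 4` used for nets of the unit sphere. -/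
theorem net_parameter {C q ε : ℝ} (hC : 1 < C) (hq : 1 < q) (hε : 0 < ε) (hε1 : ε ≤ 1 / 8) :
    ∃ τ : ℝ, 0 < τ ∧ 3 * τ < 1 ∧ 2 * (C * (3 * τ) ^ q) ≤ ε / 4 ∧
      ∀ n : ℕ, (3 / τ) ^ n ≤ 96 ^ n * (C / ε) ^ ((n : ℝ) / q) := by
  have hq0 : 0 < q := by linarith
  have hC0 : 0 < C := by linarith
  set b := (ε / (8 * C)) ^ (1 / q) with hb
  have hb0 : 0 < b := by positivity
  have hb1 : b ≤ 1 := Real.rpow_le_one (by positivity)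
    (by rw [div_le_one (by positivity)]; linarith) (by positivity)
  have hbq : b ^ q = ε / (8 * C) := by
    rw [hb, ← Real.rpow_mul (by positivity), one_div_mul_cancel hq0.ne', Real.rpow_one]
  refine ⟨b / 4, by positivity, by linarith, ?_, fun n => ?_⟩
  · have : (3 * (b / 4)) ^ q ≤ b ^ q := by
      gcongr
      linarith
    calc 2 * (C * (3 * (b / 4)) ^ q) ≤ 2 * (C * b ^ q) := by gcongr
      _ = ε / 4 := by
        rw [hbq]
        field_simp
        norm_num
  · have hinv : 1 / b ≤ 8 * (C / ε) ^ (1 / q) := by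
      calc 1 / b = (8 * (C / ε)) ^ (1 / q) := by
            rw [hb, one_div, ← Real.inv_rpow (by positivity)]
            congr 1
            field_simp
        _ = 8 ^ (1 / q) * (C / ε) ^ (1 / q) := Real.mul_rpow (by norm_num) (by positivity)
        _ ≤ 8 * (C / ε) ^ (1 / q) := by
          gcongr
          exact Real.rpow_le_self_of_one_le (by norm_num) ((div_le_one hq0).2 hq.le)
    calc (3 / (b / 4)) ^ n = (12 * (1 / b)) ^ n := by
          congr 1
          field_simp
          norm_num
      _ ≤ (12 * (8 * (C / ε) ^ (1 / q))) ^ n := by gcongr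
      _ = 96 ^ n * ((C / ε) ^ (1 / q)) ^ n := by
        rw [← mul_assoc, mul_pow]
        norm_num
      _ = 96 ^ n * (C / ε) ^ ((n : ℝ) / q) := by
        rw [← Real.rpow_natCast ((C / ε) ^ (1 / q)), ← Real.rpow_mul (by positivity), one_div_mul_eq_div]

/-- The hypothesis on `ε` forces `ε ≤ 1 / 8`. -/
theorem le_one_eighth {C q ε : ℝ} (hC : 1 < C) (hq : 1 < q)
    (hε : ε ≤ (8 * C ^ (1 / q)) ^ (-(q / (q - 1)))) : ε ≤ 1 / 8 := by
  have hq1 : 0 < q - 1 := by linarith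
  have hC1 : 1 ≤ C ^ (1 / q) := Real.one_le_rpow hC.le (by positivity)
  have hexp : -(q / (q - 1)) ≤ -1 := by
    rw [neg_le_neg_iff, one_le_div hq1]
    linarith
  calc ε ≤ (8 * C ^ (1 / q)) ^ (-(q / (q - 1))) := hε
    _ ≤ (8 * C ^ (1 / q)) ^ (-1 : ℝ) := Real.rpow_le_rpow_of_exponent_le (by linarith) hexp
    _ = 1 / (8 * C ^ (1 / q)) := by rw [Real.rpow_neg_one, one_div (8 * _)]
    _ ≤ 1 / 8 := by
      gcongr
      linarith

/-- A uniformly smooth unit ball has few points such that every point of the ball lies in the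
largest symmetric body at one of them whose double stays in the ball of radius `1 + ε`. -/
theorem exists_centers {n : ℕ} {K : Set (Fin n → ℝ)} {p : Seminorm ℝ (Fin n → ℝ)} {C q ε : ℝ}
    (hpK : ∀ x, x ∈ K ↔ p x ≤ 1) (hK : IsCompact K) (hint : (interior K).Nonempty)
    (hsm : ∀ x s, p x = 1 → p s < 1 → p (x + s) + p (x - s) ≤ 2 + 2 * (C * p s ^ q))
    (hC : 1 < C) (hq : 1 < q) (hε : 0 < ε) (hε1 : ε ≤ 1 / 8) :
    ∃ T : Finset (Fin n → ℝ),
      (T.card : ℝ) ≤ (4 * Real.logb 2 (1 / ε) + 1) * (96 ^ n * (C / ε) ^ ((n : ℝ) / q)) + 1 ∧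
      (∀ a ∈ T, p a ≤ 1) ∧
      ∀ z ∈ K, ∃ a ∈ T, p (a + (2 : ℝ) • (z - a)) ≤ 1 + ε ∧ p (a - (2 : ℝ) • (z - a)) ≤ 1 + ε := by
  classical
  obtain ⟨τ, hτ, hτ1, hη, hτn⟩ := net_parameter hC hq hε hε1
  obtain ⟨A, hA, hAcard, hAnet⟩ := exists_net_of_card_le p {x | p x = 1} hτ.le fun A hA hsep =>
    card_le_of_separated_s7 hpK hK.measurableSet
      (MeasureTheory.Measure.measure_pos_of_nonempty_interior _ hint).ne' hK.measure_lt_top.ne hτ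
      (by linarith) A hA hsep
  set L := ⌊4 * Real.logb 2 (1 / ε)⌋₊ + 1 with hL
  have hlog : 0 ≤ Real.logb 2 (1 / ε) :=
    Real.logb_nonneg (by norm_num) (by rw [le_div_iff₀ hε]; linarith)
  have hLle : (L : ℝ) ≤ 4 * Real.logb 2 (1 / ε) + 1 := by
    rw [hL, Nat.cast_add_one]
    linarith [Nat.floor_le (show 0 ≤ 4 * Real.logb 2 (1 / ε) by positivity)]
  let f : ℕ × (Fin n → ℝ) → (Fin n → ℝ) := fun x => max 0 (1 + ε - ε * (5 / 4) ^ x.1) • x.2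
  refine ⟨insert 0 ((Finset.range L ×ˢ A).image f), ?_, ?_, ?_⟩
  · have h1 : (insert 0 ((Finset.range L ×ˢ A).image f)).card ≤ L * A.card + 1 := by
      refine (Finset.card_insert_le _ _).trans (Nat.add_le_add_right ?_ 1)
      exact Finset.card_image_le.trans (by rw [Finset.card_product, Finset.card_range])
    calc ((insert 0 ((Finset.range L ×ˢ A).image f)).card : ℝ) ≤ L * A.card + 1 := by
          exact_mod_cast h1
      _ ≤ _ := by
        gcongr
        exact hAcard.trans (hτn n)
  · intro a ha
    rcases Finset.mem_insert.1 ha with rfl | ha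
    · rw [map_zero]
      exact zero_le_one
    · obtain ⟨⟨i, u⟩, hiu, rfl⟩ := Finset.mem_image.1 ha
      have hu : p u = 1 := hA u (Finset.mem_product.1 hiu).2
      have : (1 : ℝ) ≤ (5 / 4) ^ i := one_le_pow₀ (by norm_num)
      rw [map_smul_eq_mul, Real.norm_of_nonneg (le_max_left _ _), hu, mul_one]
      exact max_le zero_le_one (by nlinarith)
  · intro z hz
    rw [hpK] at hz
    rcases le_total (p z) (1 / 2) with hz2 | hz2
    · refine ⟨0, Finset.mem_insert_self _ _, ?_⟩
      rw [sub_zero, zero_add, zero_sub, map_neg_eq_map, map_smul_eq_mul,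
        Real.norm_of_nonneg zero_le_two]
      constructor <;> linarith
    · have hz0 : 0 < p z := by linarith
      set v := (p z)⁻¹ • z
      have hv : p v = 1 := by
        rw [map_smul_eq_mul, norm_inv, Real.norm_of_nonneg hz0.le, inv_mul_cancel₀ hz0.ne']
      have hzv : z = p z • v := by rw [smul_inv_smul₀ hz0.ne']
      obtain ⟨u, huA, hu⟩ := hAnet v hv
      obtain ⟨i, hi, hE, hE'⟩ := exists_scale (D := 1 + ε - p z) hε (by linarith) (by linarith)
      have hE1 : (1 : ℝ) ≤ (5 / 4) ^ i := one_le_pow₀ (by norm_num)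
      refine ⟨f (i, u), Finset.mem_insert_of_mem (Finset.mem_image_of_mem f
        (Finset.mem_product.2 ⟨Finset.mem_range.2 hi, huA⟩)), ?_⟩
      have hf : f (i, u) = (1 + ε - ε * (5 / 4) ^ i) • u := by
        simp only [f]
        rw [max_eq_right (by linarith)]
      rw [hf, hzv]
      exact seminorm_double_le hsm (by linarith) (by linarith) (hA u huA) hv hu hτ1 hε1 hη hz2
        (by linarith) (by nlinarith) (by linarith)

/-- If an origin-symmetric convex body `K ⊆ ℝⁿ` has modulus of smoothness bounded by `C τ^q`
with `C, q > 1`, then for `ε ∈ (0, (8 C^{1/q})^{-q/(q-1)}]` it admits a symmetric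
`(2,ε)`-covering by at most `2^{cn} (1 + log₂(1/ε)) (C/ε)^{n/q}` origin-symmetric convex
bodies, with an absolute constant `c > 0`. Here `‖·‖_K` is the gauge of `K`. -/
theorem stmt_7 :
    ∃ c : ℝ, 0 < c ∧ ∀ n : ℕ, 1 ≤ n → ∀ K : Set (Fin n → ℝ),
      IsCompact K → Convex ℝ K → (interior K).Nonempty → K = -K →
      ∀ C q : ℝ, 1 < C → 1 < q →
      (∀ τ ∈ Set.Ioo (0 : ℝ) 1, ∀ x y : Fin n → ℝ,
        gauge K x = 1 → gauge K y = 1 →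
        gauge K (x + τ • y) + gauge K (x - τ • y) - 2 ≤ 2 * (C * τ ^ q)) →
      ∀ ε : ℝ, 0 < ε → ε ≤ (8 * C ^ (1 / q)) ^ (-(q / (q - 1))) →
      ∃ (N : ℕ) (cs : Fin N → (Fin n → ℝ)) (S : Fin N → Set (Fin n → ℝ)),
        (N : ℝ) ≤ 2 ^ (c * (n : ℝ)) * (1 + Real.logb 2 (1 / ε)) * (C / ε) ^ ((n : ℝ) / q) ∧
        (∀ j, IsCompact (S j) ∧ Convex ℝ (S j) ∧ (interior (S j)).Nonempty ∧ S j = -S j) ∧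
        K ⊆ ⋃ j, cs j +ᵥ S j ∧
        (∀ j, cs j +ᵥ (2 : ℝ) • S j ⊆ (1 + ε) • K) := by
  refine ⟨9, by norm_num, ?_⟩
  intro n hn K hK hconv hint hsymm C q hC hq hmod ε hε hε'
  have hε1 := le_one_eighth hC hq hε'
  have hneg : ∀ x ∈ K, -x ∈ K := fun x hx => by
    rw [hsymm] at hx
    exact hx
  have hbal : Balanced ℝ K := (balanced_iff_neg_mem hconv).2 fun {x} hx => hneg x hx
  have hnhds : K ∈ nhds (0 : Fin n → ℝ) := by
    obtain ⟨x, hx⟩ := hint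
    have hx' : -x ∈ K := hneg x (interior_subset hx)
    have := hconv.combo_interior_self_mem_interior hx hx' (a := 1 / 2) (b := 1 / 2)
      (by norm_num) (by norm_num) (by norm_num)
    rw [smul_neg, add_neg_cancel] at this
    exact mem_interior_iff_mem_nhds.1 this
  have habs : Absorbent ℝ K := absorbent_nhds_zero hnhds
  let p : Seminorm ℝ (Fin n → ℝ) := gaugeSeminorm hbal hconv habs
  have hcont : Continuous p := continuous_gauge hconv hnhds
  have hpK : ∀ x, x ∈ K ↔ p x ≤ 1 := fun x => by
    change _ ↔ gauge K x ≤ 1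
    rw [gauge_le_one_iff_mem_closure hconv hnhds, hK.isClosed.closure_eq]
  have hsm : ∀ x s, p x = 1 → p s < 1 → p (x + s) + p (x - s) ≤ 2 + 2 * (C * p s ^ q) := by
    intro x s hx hs
    rcases (apply_nonneg p s).eq_or_lt with h0 | h0
    · have h1 := map_add_le_add p x s
      have h2 := map_sub_le_add p x s
      rw [← h0, Real.zero_rpow (by linarith)]
      linarith
    · have h := hmod (p s) ⟨h0, hs⟩ x ((p s)⁻¹ • s) hx (by
        change p _ = 1
        rw [map_smul_eq_mul, norm_inv, Real.norm_of_nonneg h0.le, inv_mul_cancel₀ h0.ne'])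
      rw [smul_inv_smul₀ h0.ne'] at h
      change p _ + p _ - 2 ≤ _ at h
      linarith
  obtain ⟨T, hcard, hT, hcov⟩ := exists_centers hpK hK hint hsm hC hq hε hε1
  let S : (Fin n → ℝ) → Set (Fin n → ℝ) := fun a =>
    {s | p (a + (2 : ℝ) • s) ≤ 1 + ε ∧ p (a - (2 : ℝ) • s) ≤ 1 + ε}
  have hTe : ∀ j, (T.equivFin.symm j : Fin n → ℝ) ∈ T := fun j => (T.equivFin.symm j).2
  refine ⟨T.card, fun j => T.equivFin.symm j, fun j => S (T.equivFin.symm j), ?_, ?_, ?_, ?_⟩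
  · have hlog : 0 ≤ Real.logb 2 (1 / ε) :=
      Real.logb_nonneg (by norm_num) (by rw [le_div_iff₀ hε]; linarith)
    have hX : 1 ≤ (C / ε) ^ ((n : ℝ) / q) :=
      Real.one_le_rpow (by rw [le_div_iff₀ hε]; linarith) (by positivity)
    have h96 : (1 : ℝ) ≤ 96 ^ n := one_le_pow₀ (by norm_num)
    have h512 : 5 * (96 : ℝ) ^ n ≤ 2 ^ (9 * (n : ℝ)) := by
      calc 5 * (96 : ℝ) ^ n ≤ 5 ^ n * 96 ^ n := by
            gcongr
            exact le_self_pow₀ (by norm_num) (by omega)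
        _ = 480 ^ n := by
          rw [← mul_pow]
          norm_num
        _ ≤ 512 ^ n := by
          gcongr
          norm_num
        _ = 2 ^ (9 * (n : ℝ)) := by
          rw [Real.rpow_mul (by norm_num), Real.rpow_natCast]
          norm_num
    set X := (C / ε) ^ ((n : ℝ) / q)
    set l := Real.logb 2 (1 / ε)
    have hY : 1 ≤ 96 ^ n * X := one_le_mul_of_one_le_of_one_le h96 hX
    calc (T.card : ℝ) ≤ (4 * l + 1) * (96 ^ n * X) + 1 := hcard
      _ ≤ 5 * 96 ^ n * (1 + l) * X := by nlinarith
      _ ≤ 2 ^ (9 * (n : ℝ)) * (1 + l) * X := by gcongr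
  · exact fun j => symmetric_body hpK hK hcont ((hT _ (hTe j)).trans_lt (by linarith))
  · intro z hz
    obtain ⟨a, ha, h⟩ := hcov z hz
    refine Set.mem_iUnion.2 ⟨T.equivFin ⟨a, ha⟩, ?_⟩
    beta_reduce
    rw [Equiv.symm_apply_apply, Set.mem_vadd_set_iff_neg_vadd_mem, vadd_eq_add, neg_add_eq_sub]
    exact h
  · rintro j _ ⟨_, ⟨s, hs, rfl⟩, rfl⟩
    have hR : 0 < 1 + ε := by linarith
    rw [Set.mem_smul_set_iff_inv_smul_mem₀ hR.ne', hpK, map_smul_eq_mul, norm_inv,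
      Real.norm_of_nonneg hR.le, inv_mul_le_iff₀ hR, mul_one]
    exact hs.1
end

section
/- For every fixed p ∈ [2, ∞) there exists a constant c_p > 0 such that for all n ≥ 1 and all ε ∈ (0, 1/2], the unit ball B_p^n of ℓ_p^n admits a symmetric (2,ε)-covering consisting of at most c_p^n · (1 + log₂(1/ε)) · (1/ε)^{n/2} sets: i.e., there exist points c_1,…,c_N ∈ ℝⁿ and origin-symmetric convex bodies S_1,…,S_N with N ≤ c_p^n·(1 + log₂(1/ε))·(1/ε)^{n/2}, B_p^n ⊆ ⋃_{j=1}^N (c_j + S_j) and c_j + 2S_j ⊆ (1+ε)·B_p^n for every j. -/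
open Pointwise

/-- The `ℓ_p` norm on ℝⁿ, `‖x‖_p = (Σᵢ |xᵢ|^p)^{1/p}`. -/
noncomputable def lpnorm (p : ℝ) (n : ℕ) (x : Fin n → ℝ) : ℝ :=
  (∑ i, |x i| ^ p) ^ (1 / p)

section PowerInequalities

/-- Tangent line inequality for `t ↦ t ^ m` on the nonnegative half-line. -/
lemma mul_rpow_sub_one_mul_le {m t r : ℝ} (hm : 1 ≤ m) (ht : 0 ≤ t) (hr : 0 ≤ r) :
    m * (t ^ (m - 1) * r) ≤ (m - 1) * t ^ m + r ^ m := by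
  have hm0 : 0 < m := by linarith
  have h := Real.geom_mean_le_arith_mean2_weighted (w₁ := (m - 1) / m) (w₂ := 1 / m)
    (p₁ := t ^ m) (p₂ := r ^ m) (div_nonneg (by linarith) hm0.le) (by positivity)
    (by positivity) (by positivity) (by field_simp; ring)
  rw [← Real.rpow_mul ht, ← Real.rpow_mul hr, mul_div_cancel₀ _ hm0.ne',
    mul_one_div_cancel hm0.ne', Real.rpow_one] at h
  calc m * (t ^ (m - 1) * r) ≤ m * ((m - 1) / m * t ^ m + 1 / m * r ^ m) := by gcongr
    _ = (m - 1) * t ^ m + r ^ m := by field_simp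

lemma rpow_sub_one_mul_self {m t : ℝ} (hm : 1 ≤ m) (ht : 0 ≤ t) : t ^ (m - 1) * t = t ^ m := by
  have h := Real.rpow_add_of_nonneg ht (sub_nonneg.2 hm) zero_le_one
  rw [Real.rpow_one, sub_add_cancel] at h
  exact h.symm

/-- The odd extension `t ↦ sign t * |t| ^ m` of the power function. -/
noncomputable def signedPow (m t : ℝ) : ℝ := |t| ^ (m - 1) * t

lemma signedPow_neg (m t : ℝ) : signedPow m (-t) = -signedPow m t := by
  simp [signedPow]

lemma signedPow_of_nonneg {m t : ℝ} (hm : 1 ≤ m) (ht : 0 ≤ t) : signedPow m t = t ^ m := by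
  rw [signedPow, abs_of_nonneg ht, rpow_sub_one_mul_self hm ht]

lemma signedPow_mul_self {m t : ℝ} (hm : 2 ≤ m) : signedPow (m - 1) t * t = |t| ^ m := by
  rw [signedPow, mul_assoc, ← abs_mul_abs_self t, ← mul_assoc,
    rpow_sub_one_mul_self (by linarith) (abs_nonneg t),
    rpow_sub_one_mul_self (by linarith) (abs_nonneg t)]

lemma signedPow_half_sq {p : ℝ} (hp : 2 ≤ p) (t : ℝ) : signedPow (p / 2) t ^ 2 = |t| ^ p := by
  have h : |signedPow (p / 2) t| = |t| ^ (p / 2) := by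
    rw [signedPow, abs_mul, abs_of_nonneg (by positivity),
      rpow_sub_one_mul_self (by linarith) (abs_nonneg t)]
  rw [← sq_abs, h, ← Real.rpow_natCast, ← Real.rpow_mul (abs_nonneg t)]
  congr 1
  push_cast
  ring

/-- Reduction of a symmetric statement about two reals to the same-sign and opposite-sign cases. -/
lemma same_or_opposite_sign_induction {P : ℝ → ℝ → Prop} (hswap : ∀ a b, P a b → P b a)
    (hneg : ∀ a b, P (-a) (-b) → P a b) (hle : ∀ a b, 0 ≤ a → a ≤ b → P a b)
    (hopp : ∀ a b, 0 ≤ a → 0 ≤ b → P a (-b)) (a b : ℝ) : P a b := by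
  have hpos : ∀ a b, 0 ≤ a → 0 ≤ b → P a b := fun a b ha hb ↦
    (le_total a b).elim (hle a b ha) fun h ↦ hswap _ _ (hle b a hb h)
  rcases le_total 0 a with ha | ha <;> rcases le_total 0 b with hb | hb
  · exact hpos a b ha hb
  · simpa using hopp a (-b) ha (by linarith)
  · exact hswap _ _ (by simpa using hopp b (-a) hb (by linarith))
  · exact hneg _ _ (hpos _ _ (by linarith) (by linarith))

lemma abs_signedPow_sub_le {m : ℝ} (hm : 1 ≤ m) (a b : ℝ) {M : ℝ} (ha : |a| ≤ M) (hb : |b| ≤ M) :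
    |signedPow m a - signedPow m b| ≤ m * M ^ (m - 1) * |a - b| := by
  revert ha hb
  refine same_or_opposite_sign_induction (P := fun a b ↦ |a| ≤ M → |b| ≤ M →
    |signedPow m a - signedPow m b| ≤ m * M ^ (m - 1) * |a - b|) ?_ ?_ ?_ ?_ a b
  · intro a b h ha hb
    rw [abs_sub_comm, abs_sub_comm b]
    exact h hb ha
  · intro a b h ha hb
    have h' := h (by simpa using ha) (by simpa using hb)
    rw [signedPow_neg, signedPow_neg, ← neg_add', ← neg_add', abs_neg, abs_neg] at h'
    simpa [sub_eq_add_neg] using h'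
  · intro a b ha hab _ hbM
    have hb := ha.trans hab
    rw [abs_of_nonneg hb] at hbM
    rw [signedPow_of_nonneg hm ha, signedPow_of_nonneg hm hb, abs_sub_comm, abs_sub_comm a,
      abs_of_nonneg (sub_nonneg.2 (by gcongr)), abs_of_nonneg (sub_nonneg.2 hab)]
    calc b ^ m - a ^ m ≤ m * b ^ (m - 1) * (b - a) := by
          have h1 := mul_rpow_sub_one_mul_le hm hb ha
          have h2 := rpow_sub_one_mul_self hm hb
          linear_combination h1 - m * h2
      _ ≤ m * M ^ (m - 1) * (b - a) := by
          have := sub_nonneg.2 hab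
          have := sub_nonneg.2 hm
          gcongr
  · intro a b ha hb haM hbM
    rw [abs_neg, abs_of_nonneg hb] at hbM
    rw [abs_of_nonneg ha] at haM
    have hM := ha.trans haM
    have := sub_nonneg.2 hm
    rw [signedPow_neg, sub_neg_eq_add, sub_neg_eq_add, signedPow_of_nonneg hm ha,
      signedPow_of_nonneg hm hb, abs_of_nonneg (by positivity), abs_of_nonneg (by positivity)]
    calc a ^ m + b ^ m = a ^ (m - 1) * a + b ^ (m - 1) * b := by
          rw [rpow_sub_one_mul_self hm ha, rpow_sub_one_mul_self hm hb]
      _ ≤ M ^ (m - 1) * a + M ^ (m - 1) * b := by gcongr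
      _ = 1 * M ^ (m - 1) * (a + b) := by ring
      _ ≤ m * M ^ (m - 1) * (a + b) := by gcongr

lemma max_rpow_mul_abs_sub_le {m : ℝ} (hm : 1 ≤ m) (a b : ℝ) :
    max |a| |b| ^ (m - 1) * |a - b| ≤ 2 * |signedPow m a - signedPow m b| := by
  refine same_or_opposite_sign_induction (P := fun a b ↦
    max |a| |b| ^ (m - 1) * |a - b| ≤ 2 * |signedPow m a - signedPow m b|) ?_ ?_ ?_ ?_ a b
  · intro a b h
    rwa [abs_sub_comm b, abs_sub_comm (signedPow m b), max_comm]
  · intro a b h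
    rw [signedPow_neg, signedPow_neg, ← neg_add', ← neg_add', abs_neg, abs_neg, abs_neg,
      abs_neg] at h
    simpa [sub_eq_add_neg] using h
  · intro a b ha hab
    have hb := ha.trans hab
    have hmono : a ^ m ≤ b ^ m := by gcongr
    rw [signedPow_of_nonneg hm ha, signedPow_of_nonneg hm hb, abs_sub_comm,
      abs_sub_comm (a ^ m), abs_of_nonneg (sub_nonneg.2 hmono), abs_of_nonneg (sub_nonneg.2 hab),
      abs_of_nonneg ha, abs_of_nonneg hb, max_eq_right hab]
    have h1 : a ^ (m - 1) * a ≤ b ^ (m - 1) * a := by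
      have := sub_nonneg.2 hm
      gcongr
    rw [rpow_sub_one_mul_self hm ha] at h1
    have h2 := rpow_sub_one_mul_self hm hb
    linarith [mul_sub (b ^ (m - 1)) b a]
  · intro a b ha hb
    rw [signedPow_neg, sub_neg_eq_add, sub_neg_eq_add, signedPow_of_nonneg hm ha,
      signedPow_of_nonneg hm hb, abs_neg, abs_of_nonneg (a := a ^ m + b ^ m) (by positivity),
      abs_of_nonneg (a := a + b) (by positivity), abs_of_nonneg ha, abs_of_nonneg hb]
    have hmax : max a b ^ m ≤ a ^ m + b ^ m := by
      rcases max_choice a b with h | h <;> rw [h]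
      · linarith [Real.rpow_nonneg hb m]
      · linarith [Real.rpow_nonneg ha m]
    have hM : 0 ≤ max a b := le_max_of_le_left ha
    calc max a b ^ (m - 1) * (a + b) ≤ max a b ^ (m - 1) * (2 * max a b) := by
          gcongr
          linarith [le_max_left a b, le_max_right a b]
      _ = 2 * max a b ^ m := by
          rw [← rpow_sub_one_mul_self hm hM]
          ring
      _ ≤ 2 * (a ^ m + b ^ m) := by gcongr

lemma abs_rpow_tangent_le {p : ℝ} (hp : 2 ≤ p) (a b : ℝ) :
    p * signedPow (p - 1) a * (b - a) ≤ |b| ^ p - |a| ^ p := by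
  have h1 := mul_rpow_sub_one_mul_le (m := p) (by linarith) (abs_nonneg a) (abs_nonneg b)
  have h2 := signedPow_mul_self (t := a) hp
  have h3 : |signedPow (p - 1) a| = |a| ^ (p - 1) := by
    rw [signedPow, abs_mul, abs_of_nonneg (by positivity),
      rpow_sub_one_mul_self (by linarith) (abs_nonneg a)]
  have h4 : p * (signedPow (p - 1) a * b) ≤ p * (|a| ^ (p - 1) * |b|) := by
    refine mul_le_mul_of_nonneg_left ?_ (by linarith)
    rw [← h3, ← abs_mul]
    exact le_abs_self _
  linear_combination h1 + h4 - p * h2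

lemma abs_rpow_remainder_le {p : ℝ} (hp : 2 ≤ p) (a b : ℝ) {M : ℝ} (ha : |a| ≤ M)
    (hb : |b| ≤ M) :
    |b| ^ p - |a| ^ p - p * signedPow (p - 1) a * (b - a) ≤
      p * (p - 1) * M ^ (p - 2) * (b - a) ^ 2 := by
  have h1 := abs_rpow_tangent_le hp b a
  have h2 := abs_signedPow_sub_le (m := p - 1) (by linarith) b a hb ha
  have h3 : (signedPow (p - 1) b - signedPow (p - 1) a) * (b - a) ≤
      (p - 1) * M ^ (p - 1 - 1) * |b - a| * |b - a| := by
    refine (le_abs_self _).trans ?_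
    rw [abs_mul]
    gcongr
  rw [mul_assoc _ |b - a|, abs_mul_abs_self, show p - 1 - 1 = p - 2 by ring] at h3
  have h4 := mul_le_mul_of_nonneg_left h3 (by linarith : 0 ≤ p)
  linear_combination h1 + h4

/-- The constant in the second-order comparison of `|·| ^ p` with its chords. -/
noncomputable def chordConst (p : ℝ) : ℝ := 24 * (p * (p - 1)) * 5 ^ (p - 2)

lemma one_le_chordConst {p : ℝ} (hp : 2 ≤ p) : 1 ≤ chordConst p := by
  have h1 : 1 ≤ (5 : ℝ) ^ (p - 2) := Real.one_le_rpow (by norm_num) (by linarith)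
  have h2 : 1 ≤ 24 * (p * (p - 1)) := by nlinarith
  exact one_le_mul_of_one_le_of_one_le h2 h1

lemma abs_rpow_extrapolate_le {p : ℝ} (hp : 2 ≤ p) (a b : ℝ) :
    |2 * b - a| ^ p ≤ 2 * |b| ^ p - |a| ^ p +
        chordConst p * (signedPow (p / 2) b - signedPow (p / 2) a) ^ 2 ∧
      |3 * a - 2 * b| ^ p ≤ 3 * |a| ^ p - 2 * |b| ^ p +
        chordConst p * (signedPow (p / 2) b - signedPow (p / 2) a) ^ 2 := by
  set M := max |a| |b|
  have hM : 0 ≤ M := le_max_of_le_left (abs_nonneg a)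
  have haM : |a| ≤ M := le_max_left _ _
  have hbM : |b| ≤ M := le_max_right _ _
  have hquad : M ^ (p - 2) * (b - a) ^ 2 ≤
      4 * (signedPow (p / 2) b - signedPow (p / 2) a) ^ 2 := by
    have h := max_rpow_mul_abs_sub_le (m := p / 2) (by linarith) a b
    have h' := pow_le_pow_left₀ (by positivity) h 2
    rw [mul_pow, mul_pow, sq_abs, sq_abs, ← Real.rpow_natCast, ← Real.rpow_mul hM] at h'
    rw [show p - 2 = (p / 2 - 1) * (2 : ℕ) by push_cast; ring]
    linear_combination h'
  have hD : p * (p - 1) * (5 * M) ^ (p - 2) * (b - a) ^ 2 * 6 ≤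
      chordConst p * (signedPow (p / 2) b - signedPow (p / 2) a) ^ 2 := by
    rw [Real.mul_rpow (by norm_num) hM, chordConst]
    have h0 : 0 ≤ p * (p - 1) * 5 ^ (p - 2) * 6 := by
      have : 0 ≤ p - 1 := by linarith
      positivity
    linear_combination mul_le_mul_of_nonneg_left hquad h0
  have h5 : |a| ≤ 5 * M := by linarith
  obtain ⟨ha1, ha2⟩ := abs_le.1 haM
  obtain ⟨hb1, hb2⟩ := abs_le.1 hbM
  have hX := abs_rpow_remainder_le hp a (2 * b - a) h5
    (abs_le.2 ⟨by linarith, by linarith⟩)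
  have hY := abs_rpow_remainder_le hp a (3 * a - 2 * b) h5
    (abs_le.2 ⟨by linarith, by linarith⟩)
  have hZ := abs_rpow_remainder_le hp a b h5 (by linarith)
  have hT := abs_rpow_tangent_le hp a b
  have hE : 0 ≤ p * (p - 1) * (5 * M) ^ (p - 2) * (b - a) ^ 2 := by
    have : 0 ≤ p - 1 := by linarith
    positivity
  constructor
  · linear_combination hX + 2 * hT + hD + 2 * hE
  · linear_combination hY + 2 * hZ + hD

end PowerInequalities

section Nets

open MeasureTheory Metric Module Function ENNReal

variable {X E : Type*} [NormedAddCommGroup E] [NormedSpace ℝ E] [FiniteDimensional ℝ E]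

/-- Volume bound for the cardinality of an `s`-separated family in the unit ball. -/
lemma card_le_of_separated_of_norm_le_one (f : X → E) (T : Finset X) {s : ℝ} (hs : 0 < s)
    (hs1 : s ≤ 1) (hT : ∀ c ∈ T, ‖f c‖ ≤ 1)
    (hsep : ∀ c ∈ T, ∀ d ∈ T, c ≠ d → s ≤ ‖f c - f d‖) :
    (T.card : ℝ) ≤ (3 / s) ^ finrank ℝ E := by
  borelize E
  let μ : Measure E := Measure.addHaar
  have hδ : 0 < s / 2 := by positivity
  have hρ : (0 : ℝ) < 3 / 2 := by norm_num
  have hdisj : (T : Set X).Pairwise (Disjoint on fun c ↦ ball (f c) (s / 2)) := by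
    intro c hc d hd hcd
    apply ball_disjoint_ball
    rw [dist_eq_norm, add_halves]
    exact hsep c hc d hd hcd
  have hsub : ⋃ c ∈ T, ball (f c) (s / 2) ⊆ ball (0 : E) (3 / 2) := by
    refine Set.iUnion₂_subset fun c hc ↦ ball_subset_ball' ?_
    rw [dist_zero_right]
    linarith [hT c hc]
  have hvol : (T.card : ℝ≥0∞) * ENNReal.ofReal ((s / 2) ^ finrank ℝ E) * μ (ball 0 1) ≤
      ENNReal.ofReal ((3 / 2) ^ finrank ℝ E) * μ (ball 0 1) := by
    rw [← μ.addHaar_ball_of_pos 0 hρ]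
    refine le_trans (le_of_eq ?_) (measure_mono hsub)
    rw [measure_biUnion_finset hdisj fun c _ ↦ measurableSet_ball]
    simp only [μ.addHaar_ball_of_pos _ hδ, Finset.sum_const, nsmul_eq_mul, mul_assoc]
  have hcard : (T.card : ℝ≥0∞) * ENNReal.ofReal ((s / 2) ^ finrank ℝ E) ≤
      ENNReal.ofReal ((3 / 2) ^ finrank ℝ E) :=
    (ENNReal.mul_le_mul_iff_left (measure_ball_pos _ _ zero_lt_one).ne' measure_ball_lt_top.ne).1
      hvol
  have h := ENNReal.toReal_le_of_le_ofReal (pow_nonneg hρ.le _) hcard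
  rw [ENNReal.toReal_mul, ENNReal.toReal_natCast, ENNReal.toReal_ofReal (by positivity),
    ← le_div_iff₀ (by positivity), ← div_pow] at h
  rwa [div_div_div_cancel_right₀ two_ne_zero] at h

lemma exists_finset_net (f : X → E) (A : Set X) {s : ℝ} (hs : 0 < s) (hs1 : s ≤ 1)
    (hA : ∀ x ∈ A, ‖f x‖ ≤ 1) :
    ∃ T : Finset X, (T : Set X) ⊆ A ∧ (T.card : ℝ) ≤ (3 / s) ^ finrank ℝ E ∧
      ∀ x ∈ A, ∃ c ∈ T, ‖f x - f c‖ ≤ s := by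
  classical
  let P : Finset X → Prop := fun T ↦ (T : Set X) ⊆ A ∧
    ∀ c ∈ T, ∀ d ∈ T, c ≠ d → s ≤ ‖f c - f d‖
  have hbound : ∀ T, P T → (T.card : ℝ) ≤ (3 / s) ^ finrank ℝ E := fun T hT ↦
    card_le_of_separated_of_norm_le_one f T hs hs1 (fun c hc ↦ hA c (hT.1 hc)) hT.2
  let R : Set ℕ := {k | ∃ T, P T ∧ T.card = k}
  have hne : R.Nonempty := ⟨0, ∅, ⟨by simp, by simp⟩, rfl⟩
  have hbdd : BddAbove R := by
    refine ⟨⌊(3 / s) ^ finrank ℝ E⌋₊, ?_⟩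
    rintro k ⟨T, hT, rfl⟩
    exact Nat.le_floor (hbound T hT)
  obtain ⟨T, hT, hTcard⟩ := Nat.sSup_mem hne hbdd
  refine ⟨T, hT.1, hbound T hT, fun x hx ↦ ?_⟩
  by_contra! hfar
  have hxT : x ∉ T := fun h ↦ by simpa [hs.not_gt] using hfar x h
  have hins : P (insert x T) := by
    refine ⟨by simpa [Set.insert_subset_iff] using ⟨hx, hT.1⟩, ?_⟩
    intro c hc d hd hcd
    rcases Finset.mem_insert.1 hc with hcx | hcT <;> rcases Finset.mem_insert.1 hd with hdx | hdT
    · exact absurd (hcx.trans hdx.symm) hcd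
    · rw [hcx]
      exact (hfar d hdT).le
    · rw [hdx, norm_sub_rev]
      exact (hfar c hcT).le
    · exact hT.2 c hcT d hdT hcd
  have := le_csSup hbdd ⟨_, hins, rfl⟩
  rw [Finset.card_insert_of_notMem hxT] at this
  omega

end Nets

section PowerSum

variable {p : ℝ} {n : ℕ}

/-- The power sum `‖x‖_p ^ p = ∑ i, |x i| ^ p`. -/
noncomputable def powSum (p : ℝ) {n : ℕ} (x : Fin n → ℝ) : ℝ := ∑ i, |x i| ^ p

lemma powSum_nonneg (x : Fin n → ℝ) : 0 ≤ powSum p x := by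
  unfold powSum
  positivity

lemma lpnorm_le_one_iff (hp : 0 < p) (x : Fin n → ℝ) : lpnorm p n x ≤ 1 ↔ powSum p x ≤ 1 := by
  have h := Real.rpow_le_rpow_iff (powSum_nonneg (p := p) x) zero_le_one (one_div_pos.2 hp)
  rwa [Real.one_rpow] at h

lemma powSum_smul {r : ℝ} (hr : 0 ≤ r) (x : Fin n → ℝ) :
    powSum p (r • x) = r ^ p * powSum p x := by
  simp [powSum, abs_mul, abs_of_nonneg hr, Real.mul_rpow hr, Finset.mul_sum]

lemma mem_smul_lpnorm_ball (hp : 1 ≤ p) {r : ℝ} (hr : 1 ≤ r) {x : Fin n → ℝ}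
    (hx : powSum p x ≤ r) : x ∈ r • {x : Fin n → ℝ | lpnorm p n x ≤ 1} := by
  have hr0 : 0 < r := by linarith
  rw [Set.mem_smul_set_iff_inv_smul_mem₀ hr0.ne', Set.mem_ofPred_eq,
    lpnorm_le_one_iff (by linarith), powSum_smul (by positivity), Real.inv_rpow hr0.le,
    inv_mul_le_one₀ (by positivity)]
  exact hx.trans (Real.self_le_rpow_of_one_le hr hp)

lemma abs_apply_le_of_powSum_le (hp : 1 ≤ p) {r : ℝ} (hr : 1 ≤ r) {x : Fin n → ℝ}
    (hx : powSum p x ≤ r) (i : Fin n) : |x i| ≤ r := by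
  by_contra! h
  have h1 : |x i| ^ p ≤ powSum p x :=
    Finset.single_le_sum (f := fun i ↦ |x i| ^ p) (fun j _ ↦ by positivity) (Finset.mem_univ i)
  linarith [Real.self_le_rpow_of_one_le (hr.trans h.le) hp]

lemma continuous_powSum (hp : 0 ≤ p) : Continuous (powSum p : (Fin n → ℝ) → ℝ) :=
  continuous_finsetSum _ fun i _ ↦ (continuous_apply i).abs.rpow_const fun _ ↦ Or.inr hp

lemma convexOn_powSum (hp : 1 ≤ p) : ConvexOn ℝ Set.univ (powSum p : (Fin n → ℝ) → ℝ) := by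
  refine ⟨convex_univ, fun x _ y _ a b ha hb hab ↦ ?_⟩
  simp only [powSum, smul_eq_mul, Finset.mul_sum, ← Finset.sum_add_distrib]
  refine Finset.sum_le_sum fun i _ ↦ ?_
  have h1 : |(a • x + b • y) i| ≤ a * |x i| + b * |y i| := by
    refine (abs_add_le _ _).trans_eq ?_
    simp [abs_mul, abs_of_nonneg ha, abs_of_nonneg hb]
  exact (Real.rpow_le_rpow (abs_nonneg _) h1 (by linarith)).trans
    ((convexOn_rpow hp).2 (abs_nonneg (x i)) (abs_nonneg (y i)) ha hb hab)

/-- Half of the largest convex body symmetric about `c` inside the sublevel set of `powSum p`. -/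
def symmCell (p r : ℝ) {n : ℕ} (c : Fin n → ℝ) : Set (Fin n → ℝ) :=
  {y | powSum p (c + (2 : ℝ) • y) ≤ r ∧ powSum p (c - (2 : ℝ) • y) ≤ r}

lemma symmCell_eq_neg (p r : ℝ) (c : Fin n → ℝ) : symmCell p r c = -symmCell p r c := by
  ext y
  simp [symmCell, and_comm, sub_eq_add_neg]

lemma isCompact_symmCell (hp : 1 ≤ p) {r : ℝ} (hr : 1 ≤ r) (c : Fin n → ℝ) :
    IsCompact (symmCell p r c) := by
  have hcont := continuous_powSum (n := n) (p := p) (by linarith)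
  refine Metric.isCompact_of_isClosed_isBounded ?_ ?_
  · exact (isClosed_le (hcont.comp (by fun_prop)) continuous_const).inter
      (isClosed_le (hcont.comp (by fun_prop)) continuous_const)
  · refine Metric.isBounded_closedBall.subset (t := Metric.closedBall 0 r) fun y hy ↦ ?_
    rw [mem_closedBall_zero_iff, pi_norm_le_iff_of_nonneg (by linarith)]
    intro i
    have h1 := abs_le.1 (abs_apply_le_of_powSum_le hp hr hy.1 i)
    have h2 := abs_le.1 (abs_apply_le_of_powSum_le hp hr hy.2 i)
    simp only [Pi.add_apply, Pi.sub_apply, Pi.smul_apply, smul_eq_mul] at h1 h2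
    rw [Real.norm_eq_abs, abs_le]
    constructor <;> linarith

lemma convex_symmCell (hp : 1 ≤ p) (r : ℝ) (c : Fin n → ℝ) : Convex ℝ (symmCell p r c) := by
  have hconv := (convexOn_powSum (n := n) hp).convex_le r
  intro x hx y hy a b ha hb hab
  have h1 := hconv ⟨trivial, hx.1⟩ ⟨trivial, hy.1⟩ ha hb hab
  have h2 := hconv ⟨trivial, hx.2⟩ ⟨trivial, hy.2⟩ ha hb hab
  have hc : c = a • c + b • c := by rw [← add_smul, hab, one_smul]
  constructor
  · rw [show c + (2 : ℝ) • (a • x + b • y) =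
      a • (c + (2 : ℝ) • x) + b • (c + (2 : ℝ) • y) by
        nth_rewrite 1 [hc]
        module]
    exact h1.2
  · rw [show c - (2 : ℝ) • (a • x + b • y) =
      a • (c - (2 : ℝ) • x) + b • (c - (2 : ℝ) • y) by
        nth_rewrite 1 [hc]
        module]
    exact h2.2

lemma interior_symmCell_nonempty (hp : 0 ≤ p) {r : ℝ} {c : Fin n → ℝ} (hc : powSum p c < r) :
    (interior (symmCell p r c)).Nonempty := by
  have hcont := continuous_powSum (n := n) (p := p) hp
  have hopen : IsOpen {y : Fin n → ℝ | powSum p (c + (2 : ℝ) • y) < r ∧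
      powSum p (c - (2 : ℝ) • y) < r} :=
    (isOpen_lt (hcont.comp (by fun_prop)) continuous_const).inter
      (isOpen_lt (hcont.comp (by fun_prop)) continuous_const)
  exact ⟨0, interior_maximal (fun y hy ↦ And.intro hy.1.le hy.2.le) hopen (by simpa using hc)⟩

/-- The coordinatewise map `x ↦ sign x * |x| ^ (p / 2)` from `ℓ_p` to `ℓ_2`. -/
noncomputable def mazurMap (p : ℝ) {n : ℕ} (x : Fin n → ℝ) : EuclideanSpace ℝ (Fin n) :=
  WithLp.toLp 2 fun i ↦ signedPow (p / 2) (x i)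

lemma norm_mazurMap_sq (hp : 2 ≤ p) (x : Fin n → ℝ) : ‖mazurMap p x‖ ^ 2 = powSum p x := by
  simp [EuclideanSpace.real_norm_sq_eq, mazurMap, signedPow_half_sq hp, powSum]

lemma powSum_extrapolate_le (hp : 2 ≤ p) (c x : Fin n → ℝ) :
    powSum p ((2 : ℝ) • x - c) ≤ 2 * powSum p x - powSum p c +
        chordConst p * ‖mazurMap p x - mazurMap p c‖ ^ 2 ∧
      powSum p ((3 : ℝ) • c - (2 : ℝ) • x) ≤ 3 * powSum p c - 2 * powSum p x +
        chordConst p * ‖mazurMap p x - mazurMap p c‖ ^ 2 := by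
  simp only [EuclideanSpace.real_norm_sq_eq, powSum, Finset.mul_sum, ← Finset.sum_sub_distrib,
    ← Finset.sum_add_distrib]
  exact ⟨Finset.sum_le_sum fun i _ ↦ (abs_rpow_extrapolate_le hp (c i) (x i)).1,
    Finset.sum_le_sum fun i _ ↦ (abs_rpow_extrapolate_le hp (c i) (x i)).2⟩

/-- The points of the unit ball whose power sum is about `2 * (3 / 4) ^ k` below `1 + ε`. -/
def shell (p ε : ℝ) (n k : ℕ) : Set (Fin n → ℝ) :=
  {x | powSum p x ≤ 1 ∧ 2 * (3 / 4) ^ (k + 1) < 1 + ε - powSum p x ∧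
    1 + ε - powSum p x ≤ 2 * (3 / 4) ^ k}

lemma exists_mem_shell {ε : ℝ} (hε : 0 < ε) (hε1 : ε ≤ 1) {x : Fin n → ℝ} (hx : powSum p x ≤ 1) :
    ∃ k < ⌊3 * (1 + Real.logb 2 (1 / ε))⌋₊ + 1, x ∈ shell p ε n k := by
  have hx0 := powSum_nonneg (p := p) x
  obtain ⟨k, hk1, hk2⟩ := exists_nat_pow_near_of_lt_one (x := (1 + ε - powSum p x) / 2)
    (y := 3 / 4) (by linarith) (by linarith) (by norm_num) (by norm_num)
  refine ⟨k, Nat.lt_succ_of_le (Nat.le_floor ?_), hx, by linarith, by linarith⟩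
  have h1 : (4 / 3 : ℝ) ^ k ≤ 2 / ε := by
    rw [le_div_iff₀ hε, show (4 / 3 : ℝ) = (3 / 4)⁻¹ by norm_num, inv_pow,
      inv_mul_le_iff₀ (by positivity)]
    linarith
  have h2 : (2 : ℝ) ^ k ≤ (2 / ε) ^ 3 := calc
    (2 : ℝ) ^ k ≤ ((4 / 3) ^ 3) ^ k := by
      gcongr
      norm_num
    _ = ((4 / 3) ^ k) ^ 3 := by rw [← pow_mul, ← pow_mul, mul_comm]
    _ ≤ (2 / ε) ^ 3 := by gcongr
  have h3 := Real.logb_le_logb_of_le (b := 2) (by norm_num) (by positivity) h2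
  rw [Real.logb_pow, Real.logb_pow, Real.logb_self_eq_one (by norm_num), div_eq_mul_one_div,
    Real.logb_mul (by norm_num) (by positivity), Real.logb_self_eq_one (by norm_num)] at h3
  simpa using h3

lemma sub_mem_symmCell_of_mem_shell (hp : 2 ≤ p) {ε : ℝ} {k : ℕ} {c x : Fin n → ℝ}
    (hc : c ∈ shell p ε n k) (hx : x ∈ shell p ε n k)
    (hcx : chordConst p * ‖mazurMap p x - mazurMap p c‖ ^ 2 ≤ ε / 4) :
    x - c ∈ symmCell p (1 + ε) c := by
  obtain ⟨h1, h2⟩ := powSum_extrapolate_le hp c x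
  obtain ⟨hc1, hc2, hc3⟩ := hc
  obtain ⟨hx1, hx2, hx3⟩ := hx
  rw [pow_succ] at hc2 hx2
  constructor
  · rw [show c + (2 : ℝ) • (x - c) = (2 : ℝ) • x - c by module]
    linarith
  · rw [show c - (2 : ℝ) • (x - c) = (3 : ℝ) • c - (2 : ℝ) • x by module]
    linarith

lemma exists_finset_shell_cover (hp : 2 ≤ p) {ε : ℝ} (hε : 0 < ε) (hε1 : ε ≤ 1) (k : ℕ) :
    ∃ T : Finset (Fin n → ℝ), (∀ c ∈ T, powSum p c ≤ 1) ∧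
      (T.card : ℝ) ≤ (6 * √(chordConst p)) ^ n * (1 / ε) ^ ((n : ℝ) / 2) ∧
      ∀ x ∈ shell p ε n k, ∃ c ∈ T, x - c ∈ symmCell p (1 + ε) c := by
  have hC := one_le_chordConst hp
  have hC0 : 0 < chordConst p := by linarith
  have hs : 0 < √(ε / (4 * chordConst p)) := by positivity
  have hs1 : √(ε / (4 * chordConst p)) ≤ 1 := by
    rw [Real.sqrt_le_one, div_le_one (by positivity)]
    linarith
  obtain ⟨T, hTA, hTcard, hTcov⟩ := exists_finset_net (mazurMap p) (shell p ε n k) hs hs1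
    fun x hx ↦ by
      rw [← sq_le_one_iff₀ (norm_nonneg _), norm_mazurMap_sq hp]
      exact hx.1
  refine ⟨T, fun c hc ↦ (hTA hc).1, hTcard.trans_eq ?_, fun x hx ↦ ?_⟩
  · have hbase : 3 / √(ε / (4 * chordConst p)) = 6 * √(chordConst p) * (1 / ε) ^ (1 / 2 : ℝ) := by
      rw [← Real.sqrt_eq_rpow, Real.sqrt_div hε.le, Real.sqrt_mul (by norm_num),
        Real.sqrt_div zero_le_one, show (4 : ℝ) = 2 ^ 2 by norm_num,
        Real.sqrt_sq (by norm_num), Real.sqrt_one]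
      field_simp
      norm_num
    rw [finrank_euclideanSpace_fin, hbase, mul_pow, ← Real.rpow_natCast ((1 / ε) ^ (1 / 2 : ℝ)),
      ← Real.rpow_mul (by positivity)]
    congr 2
    ring
  · obtain ⟨c, hc, hcx⟩ := hTcov x hx
    refine ⟨c, hc, sub_mem_symmCell_of_mem_shell hp (hTA hc) hx ?_⟩
    calc chordConst p * ‖mazurMap p x - mazurMap p c‖ ^ 2
        ≤ chordConst p * √(ε / (4 * chordConst p)) ^ 2 := by gcongr
      _ = ε / 4 := by
        rw [Real.sq_sqrt (by positivity)]
        field_simp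

end PowerSum

/-- For every fixed `p ∈ [2,∞)` there is a constant `c_p > 0` such that for all `n ≥ 1` and
`ε ∈ (0, 1/2]` the unit ball of `ℓ_p^n` admits a symmetric `(2,ε)`-covering by at most
`c_p^n (1 + log₂(1/ε)) (1/ε)^{n/2}` origin-symmetric convex bodies. -/
theorem stmt_12 (p : ℝ) (hp : 2 ≤ p) :
    ∃ cp : ℝ, 0 < cp ∧ ∀ n : ℕ, 1 ≤ n → ∀ ε : ℝ, 0 < ε → ε ≤ 1 / 2 →
      ∃ (N : ℕ) (c : Fin N → (Fin n → ℝ)) (S : Fin N → Set (Fin n → ℝ)),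
        (N : ℝ) ≤ cp ^ n * (1 + Real.logb 2 (1 / ε)) * (1 / ε) ^ ((n : ℝ) / 2) ∧
        (∀ j, IsCompact (S j) ∧ Convex ℝ (S j) ∧ (interior (S j)).Nonempty ∧ S j = -S j) ∧
        {x : Fin n → ℝ | lpnorm p n x ≤ 1} ⊆ ⋃ j, c j +ᵥ S j ∧
        (∀ j, c j +ᵥ (2 : ℝ) • S j ⊆ (1 + ε) • {x : Fin n → ℝ | lpnorm p n x ≤ 1}) := by
  have hC := one_le_chordConst hp
  have hp0 : 0 < p := by linarith
  have hp1 : 1 ≤ p := by linarith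
  refine ⟨24 * √(chordConst p), by positivity, fun n hn ε hε hε2 ↦ ?_⟩
  choose T hT1 hTcard hTcov using
    exists_finset_shell_cover (n := n) hp hε (by linarith : ε ≤ 1)
  classical
  set L := Real.logb 2 (1 / ε)
  have hL : 0 ≤ L := Real.logb_nonneg (by norm_num) (by rw [le_div_iff₀ hε]; linarith)
  set K := ⌊3 * (1 + L)⌋₊ + 1
  have hK : (K : ℝ) ≤ 4 * (1 + L) := by
    have := Nat.floor_le (by positivity : 0 ≤ 3 * (1 + L))
    push_cast [K]
    linarith
  let U := (Finset.range K).biUnion T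
  have hU1 : ∀ c ∈ U, powSum p c ≤ 1 := fun c hc ↦ by
    obtain ⟨k, -, hk⟩ := Finset.mem_biUnion.1 hc
    exact hT1 k c hk
  let center : Fin U.card → (Fin n → ℝ) := fun j ↦ U.equivFin.symm j
  have hcenter : ∀ j, powSum p (center j) ≤ 1 := fun j ↦ hU1 _ (U.equivFin.symm j).2
  refine ⟨U.card, center, fun j ↦ symmCell p (1 + ε) (center j), ?_, fun j ↦ ?_, ?_, fun j ↦ ?_⟩
  · calc (U.card : ℝ) ≤ ∑ k ∈ Finset.range K, ((T k).card : ℝ) := mod_cast Finset.card_biUnion_le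
      _ ≤ ∑ _k ∈ Finset.range K, (6 * √(chordConst p)) ^ n * (1 / ε) ^ ((n : ℝ) / 2) :=
        Finset.sum_le_sum fun k _ ↦ hTcard k
      _ = K * ((6 * √(chordConst p)) ^ n * (1 / ε) ^ ((n : ℝ) / 2)) := by simp
      _ ≤ 4 ^ n * (1 + L) * ((6 * √(chordConst p)) ^ n * (1 / ε) ^ ((n : ℝ) / 2)) := by
        gcongr
        refine hK.trans ?_
        gcongr
        exact le_self_pow₀ (by norm_num) (by omega)
      _ = (24 * √(chordConst p)) ^ n * (1 + L) * (1 / ε) ^ ((n : ℝ) / 2) := by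
        rw [show 24 * √(chordConst p) = 4 * (6 * √(chordConst p)) by ring, mul_pow 4]
        ring
  · exact ⟨isCompact_symmCell hp1 (by linarith) _, convex_symmCell hp1 _ _,
      interior_symmCell_nonempty hp0.le (by linarith [hcenter j]), symmCell_eq_neg _ _ _⟩
  · intro x hx
    obtain ⟨k, hk, hxk⟩ := exists_mem_shell hε (by linarith) ((lpnorm_le_one_iff hp0 x).1 hx)
    obtain ⟨c, hc, hcx⟩ := hTcov k x hxk
    have hcU : c ∈ U := Finset.mem_biUnion.2 ⟨k, Finset.mem_range.2 hk, hc⟩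
    have hj : center (U.equivFin ⟨c, hcU⟩) = c := by simp [center]
    refine Set.mem_iUnion.2 ⟨U.equivFin ⟨c, hcU⟩, x - c, ?_, ?_⟩
    · simpa only [hj] using hcx
    · simp [hj]
  · rintro _ ⟨_, ⟨y, hy, rfl⟩, rfl⟩
    exact mem_smul_lpnorm_ball hp1 (by linarith) hy.1
end
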